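/- Adversary states under the glued path-recording operator and under three composed path-recording operators are close. There is a universal constant C > 0 such that for all n, λ, t ∈ ℕ and every 2t-query adversary A = (A₁, B₁, …, A_t, B_t) of unitaries on ℋ_A ⊗ ℋ_B ⊗ ℋ_C ⊗ ℋ_D, ‖ |A^{V^{glued}, V^{glued,†}}⟩ − |A^{V³V²V¹, (V³V²V¹)^{†}}⟩ ‖₂ ≤ C · t³ / 2^{λ}, where for an operator O on the purified space, |A^{O,O†}⟩ = ∏_{i=1}^{t} ( O† B_i O A_i ) |0⟩_{ABC} |0⟩_D |∅⟩_{S₁} |∅⟩_{T₁} |∅⟩_{S₂} |∅⟩_{T₂} |∅⟩_{S₃} |∅⟩_{T₃}. -/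

import Mathlib

noncomputable section
open MeasureTheory Matrix
open scoped ComplexOrder

/-- `n`-bit strings, indexing the computational basis of an `n`-qubit register. -/
abbrev BS (n : ℕ) := Fin n → Bool

/-- ℓ²-space with orthonormal basis indexed by `ι`. -/
abbrev QState (ι : Type) := lp (fun _ : ι => ℂ) 2

/-- basis vector (ket) labelled by `i`. -/
def ket {ι : Type} (i : ι) : QState ι :=
  letI := Classical.decEq ι
  lp.single 2 i 1

/-- inverse of a relation. -/
def dbInv {σ : Type} (R : Multiset (σ × σ)) : Multiset (σ × σ) := R.map fun p => (p.2, p.1)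

/-- image (set of second coordinates) of a relation. -/
def dbIm {σ : Type} [DecidableEq σ] (R : Multiset (σ × σ)) : Finset σ :=
  (R.map Prod.snd).toFinset

/-- The index set of the computational basis of the purified space for the
gluing construction: the query registers `A ⊗ B ⊗ C`, the auxiliary register
`D`, together with the six relation databases
`(L₁,R₁), (L₂,R₂), (L₃,R₃)`; systems 1 and 3 record relations on `AB`-labels
and system 2 records relations on `BC`-labels. -/
abbrev GluedIdx (n lam : ℕ) (D : Type) :=
  ((BS n × BS lam × BS n) × D) ×
    ((Multiset ((BS n × BS lam) × (BS n × BS lam)) ×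
      Multiset ((BS n × BS lam) × (BS n × BS lam))) ×
     (Multiset ((BS lam × BS n) × (BS lam × BS n)) ×
      Multiset ((BS lam × BS n) × (BS lam × BS n))) ×
     (Multiset ((BS n × BS lam) × (BS n × BS lam)) ×
      Multiset ((BS n × BS lam) × (BS n × BS lam))))

/-- operators on the purified space. -/
abbrev GOp (n lam : ℕ) (D : Type) := QState (GluedIdx n lam D) →L[ℂ] QState (GluedIdx n lam D)

/-- `V` is the left path-recording operator of system 1 (acting on registers
`A,B` and the databases `S₁ = L₁`, `T₁ = R₁`). -/
def IsVL1 {n lam : ℕ} {D : Type} (V : GOp n lam D) : Prop :=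
  ∀ (a : BS n) (b : BS lam) (c : BS n) (d : D)
    (L1 R1 : Multiset ((BS n × BS lam) × (BS n × BS lam)))
    (L2 R2 : Multiset ((BS lam × BS n) × (BS lam × BS n)))
    (L3 R3 : Multiset ((BS n × BS lam) × (BS n × BS lam))),
    V (ket (((a, b, c), d), ((L1, R1), (L2, R2), (L3, R3)))) =
      (↑(Real.sqrt ((2 : ℝ) ^ (n + lam) - (dbIm (L1 + dbInv R1)).card)) : ℂ)⁻¹ •
        ∑ y ∈ (dbIm (L1 + dbInv R1))ᶜ,
          ket (((y.1, y.2, c), d), ((((a, b), y) ::ₘ L1, R1), (L2, R2), (L3, R3)))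

/-- `V` is the right path-recording operator of system 1. -/
def IsVR1 {n lam : ℕ} {D : Type} (V : GOp n lam D) : Prop :=
  ∀ (a : BS n) (b : BS lam) (c : BS n) (d : D)
    (L1 R1 : Multiset ((BS n × BS lam) × (BS n × BS lam)))
    (L2 R2 : Multiset ((BS lam × BS n) × (BS lam × BS n)))
    (L3 R3 : Multiset ((BS n × BS lam) × (BS n × BS lam))),
    V (ket (((a, b, c), d), ((L1, R1), (L2, R2), (L3, R3)))) =
      (↑(Real.sqrt ((2 : ℝ) ^ (n + lam) - (dbIm (R1 + dbInv L1)).card)) : ℂ)⁻¹ •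
        ∑ y ∈ (dbIm (R1 + dbInv L1))ᶜ,
          ket (((y.1, y.2, c), d), ((L1, ((a, b), y) ::ₘ R1), (L2, R2), (L3, R3)))

/-- `V` is the left path-recording operator of system 2 (acting on registers
`B,C` and the databases `S₂ = L₂`, `T₂ = R₂`). -/
def IsVL2 {n lam : ℕ} {D : Type} (V : GOp n lam D) : Prop :=
  ∀ (a : BS n) (b : BS lam) (c : BS n) (d : D)
    (L1 R1 : Multiset ((BS n × BS lam) × (BS n × BS lam)))
    (L2 R2 : Multiset ((BS lam × BS n) × (BS lam × BS n)))
    (L3 R3 : Multiset ((BS n × BS lam) × (BS n × BS lam))),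
    V (ket (((a, b, c), d), ((L1, R1), (L2, R2), (L3, R3)))) =
      (↑(Real.sqrt ((2 : ℝ) ^ (n + lam) - (dbIm (L2 + dbInv R2)).card)) : ℂ)⁻¹ •
        ∑ y ∈ (dbIm (L2 + dbInv R2))ᶜ,
          ket (((a, y.1, y.2), d), ((L1, R1), (((b, c), y) ::ₘ L2, R2), (L3, R3)))

/-- `V` is the right path-recording operator of system 2. -/
def IsVR2 {n lam : ℕ} {D : Type} (V : GOp n lam D) : Prop :=
  ∀ (a : BS n) (b : BS lam) (c : BS n) (d : D)
    (L1 R1 : Multiset ((BS n × BS lam) × (BS n × BS lam)))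
    (L2 R2 : Multiset ((BS lam × BS n) × (BS lam × BS n)))
    (L3 R3 : Multiset ((BS n × BS lam) × (BS n × BS lam))),
    V (ket (((a, b, c), d), ((L1, R1), (L2, R2), (L3, R3)))) =
      (↑(Real.sqrt ((2 : ℝ) ^ (n + lam) - (dbIm (R2 + dbInv L2)).card)) : ℂ)⁻¹ •
        ∑ y ∈ (dbIm (R2 + dbInv L2))ᶜ,
          ket (((a, y.1, y.2), d), ((L1, R1), (L2, ((b, c), y) ::ₘ R2), (L3, R3)))

/-- `V` is the left path-recording operator of system 3 (acting on registers
`A,B` and the databases `S₃ = L₃`, `T₃ = R₃`). -/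
def IsVL3 {n lam : ℕ} {D : Type} (V : GOp n lam D) : Prop :=
  ∀ (a : BS n) (b : BS lam) (c : BS n) (d : D)
    (L1 R1 : Multiset ((BS n × BS lam) × (BS n × BS lam)))
    (L2 R2 : Multiset ((BS lam × BS n) × (BS lam × BS n)))
    (L3 R3 : Multiset ((BS n × BS lam) × (BS n × BS lam))),
    V (ket (((a, b, c), d), ((L1, R1), (L2, R2), (L3, R3)))) =
      (↑(Real.sqrt ((2 : ℝ) ^ (n + lam) - (dbIm (L3 + dbInv R3)).card)) : ℂ)⁻¹ •
        ∑ y ∈ (dbIm (L3 + dbInv R3))ᶜ,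
          ket (((y.1, y.2, c), d), ((L1, R1), (L2, R2), (((a, b), y) ::ₘ L3, R3)))

/-- `V` is the right path-recording operator of system 3. -/
def IsVR3 {n lam : ℕ} {D : Type} (V : GOp n lam D) : Prop :=
  ∀ (a : BS n) (b : BS lam) (c : BS n) (d : D)
    (L1 R1 : Multiset ((BS n × BS lam) × (BS n × BS lam)))
    (L2 R2 : Multiset ((BS lam × BS n) × (BS lam × BS n)))
    (L3 R3 : Multiset ((BS n × BS lam) × (BS n × BS lam))),
    V (ket (((a, b, c), d), ((L1, R1), (L2, R2), (L3, R3)))) =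
      (↑(Real.sqrt ((2 : ℝ) ^ (n + lam) - (dbIm (R3 + dbInv L3)).card)) : ℂ)⁻¹ •
        ∑ y ∈ (dbIm (R3 + dbInv L3))ᶜ,
          ket (((y.1, y.2, c), d), ((L1, R1), (L2, R2), (L3, ((a, b), y) ::ₘ R3)))

/-- `P` is the orthogonal projection onto the span of basis states whose six
databases have total size at most `t`. -/
def IsPt {n lam : ℕ} {D : Type} (t : ℕ) (P : GOp n lam D) : Prop :=
  ∀ (x : (BS n × BS lam × BS n) × D)
    (L1 R1 : Multiset ((BS n × BS lam) × (BS n × BS lam)))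
    (L2 R2 : Multiset ((BS lam × BS n) × (BS lam × BS n)))
    (L3 R3 : Multiset ((BS n × BS lam) × (BS n × BS lam))),
    P (ket (x, ((L1, R1), (L2, R2), (L3, R3)))) =
      if Multiset.card L1 + Multiset.card R1 + Multiset.card L2 + Multiset.card R2 +
          Multiset.card L3 + Multiset.card R3 ≤ t then
        ket (x, ((L1, R1), (L2, R2), (L3, R3)))
      else 0

/-- the combined path-recording operator
`V = V_L (I − V_R V_R†) + (I − V_L V_L†) V_R†`. -/
def prV {E : Type*} [NormedAddCommGroup E] [InnerProductSpace ℂ E] [CompleteSpace E]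
    (VL VR : E →L[ℂ] E) : E →L[ℂ] E :=
  VL * (1 - VR * ContinuousLinearMap.adjoint VR) +
    (1 - VL * ContinuousLinearMap.adjoint VL) * ContinuousLinearMap.adjoint VR

/-- The glued path-recording operator
`V^{glued} = Π^{L,321} V_L³ V_L² V_L¹ (I − Π^{R,1})
  + (Π^{L,32} − Π^{L,321}) V_L³ V_L² V_R^{1,†} (Π^{R,1} − Π^{R,12})
  + (Π^{L,3} − Π^{L,32}) V_L³ V_R^{2,†} V_R^{1,†} (Π^{R,12} − Π^{R,123})
  + (I − Π^{L,3}) V_R^{3,†} V_R^{2,†} V_R^{1,†} Π^{R,123}`. -/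
def gluedOp {E : Type*} [NormedAddCommGroup E] [InnerProductSpace ℂ E] [CompleteSpace E]
    (VL1 VR1 VL2 VR2 VL3 VR3 : E →L[ℂ] E) : E →L[ℂ] E :=
  let dag : (E →L[ℂ] E) → (E →L[ℂ] E) := fun T => ContinuousLinearMap.adjoint T
  let PR1 := VR1 * dag VR1
  let PR12 := VR1 * VR2 * dag VR2 * dag VR1
  let PR123 := VR1 * VR2 * VR3 * dag VR3 * dag VR2 * dag VR1
  let PL3 := VL3 * dag VL3
  let PL32 := VL3 * VL2 * dag VL2 * dag VL3
  let PL321 := VL3 * VL2 * VL1 * dag VL1 * dag VL2 * dag VL3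
  PL321 * (VL3 * VL2 * VL1) * (1 - PR1)
    + (PL32 - PL321) * (VL3 * VL2 * dag VR1) * (PR1 - PR12)
    + (PL3 - PL32) * (VL3 * dag VR2 * dag VR1) * (PR12 - PR123)
    + (1 - PL3) * (dag VR3 * dag VR2 * dag VR1) * PR123

/-- `T` is the lift of the unitary `M` on the query and auxiliary registers
`A ⊗ B ⊗ C ⊗ D`, acting as the identity on the six database registers. -/
def IsLift {n lam : ℕ} {D : Type} [Fintype D] [DecidableEq D]
    (M : Matrix.unitaryGroup ((BS n × BS lam × BS n) × D) ℂ) (T : GOp n lam D) : Prop :=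
  ∀ (k : BS n × BS lam × BS n) (d : D)
    (L1 R1 : Multiset ((BS n × BS lam) × (BS n × BS lam)))
    (L2 R2 : Multiset ((BS lam × BS n) × (BS lam × BS n)))
    (L3 R3 : Multiset ((BS n × BS lam) × (BS n × BS lam))),
    T (ket ((k, d), ((L1, R1), (L2, R2), (L3, R3)))) =
      ∑ p : (BS n × BS lam × BS n) × D,
        ((M : Matrix ((BS n × BS lam × BS n) × D) ((BS n × BS lam × BS n) × D) ℂ) p (k, d)) •
          ket (p, ((L1, R1), (L2, R2), (L3, R3)))

/-- the result of applying the `t` maps `step 0, step 1, …, step (t-1)`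
(in this order, `step 0` first) to the initial state `init`. -/
def iterQuery {H : Type*} (t : ℕ) (step : Fin t → H → H) (init : H) : H :=
  (List.finRange t).foldl (fun v i => step i v) init

section Kets

variable {ι : Type}

theorem ket_apply [DecidableEq ι] (i j : ι) : (ket i : QState ι) j = if j = i then 1 else 0 := by
  classical
  by_cases h : j = i
  · subst h; simp [ket]
  · simp [ket, h]

theorem inner_ket_left (i : ι) (v : QState ι) : inner ℂ (ket i) v = v i := by
  simp [ket, lp.inner_single_left]

theorem inner_ket_ket [DecidableEq ι] (i j : ι) :
    inner ℂ (ket i : QState ι) (ket j) = if i = j then 1 else 0 := by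
  rw [inner_ket_left, ket_apply]

theorem adjoint_ket_apply (T : QState ι →L[ℂ] QState ι) (i j : ι) :
    (ContinuousLinearMap.adjoint T (ket i)) j = star ((T (ket j)) i) := by
  rw [← inner_ket_left, ContinuousLinearMap.adjoint_inner_right, ← inner_conj_symm, inner_ket_left]
  rfl

theorem apply_eq_inner (T : QState ι →L[ℂ] QState ι) (v : QState ι) (i : ι) :
    (T v) i = inner ℂ (ContinuousLinearMap.adjoint T (ket i)) v := by
  rw [ContinuousLinearMap.adjoint_inner_left, inner_ket_left]

theorem clm_ext_ket {T T' : QState ι →L[ℂ] QState ι} (h : ∀ j, T (ket j) = T' (ket j)) :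
    T = T' := by
  ext v i
  rw [apply_eq_inner, apply_eq_inner]
  congr 1
  ext j
  rw [adjoint_ket_apply, adjoint_ket_apply, h]

theorem norm_sq_eq_tsum (v : QState ι) : HasSum (fun i => ‖v i‖ ^ 2) (‖v‖ ^ 2) := by
  have h := lp.hasSum_norm (p := 2) (by norm_num) v
  simpa using h

/-- If the images of the kets are pairwise orthogonal with squared norms `d j`, then `d` controls
the norm of `T` on vectors. -/
theorem norm_sq_le_of_gram_diag [DecidableEq ι] (T : QState ι →L[ℂ] QState ι) (d : ι → ℝ)
    (h : ∀ i j, inner ℂ (T (ket i)) (T (ket j)) = if i = j then (d j : ℂ) else 0)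
    (v : QState ι) (ρ : ℝ) (hd : ∀ j, v j ≠ 0 → d j ≤ ρ) : ‖T v‖ ^ 2 ≤ ρ * ‖v‖ ^ 2 := by
  have hT : ∀ j, ContinuousLinearMap.adjoint T (T (ket j)) = (d j : ℂ) • ket j := by
    intro j
    ext i
    rw [← inner_ket_left, ContinuousLinearMap.adjoint_inner_right, h]
    simp only [lp.coeFn_smul, Pi.smul_apply, ket_apply, smul_eq_mul]
    split_ifs <;> simp
  have hTv : ∀ j, (ContinuousLinearMap.adjoint T (T v)) j = (d j : ℂ) * v j := by
    intro j
    rw [← inner_ket_left, ContinuousLinearMap.adjoint_inner_right,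
      ← ContinuousLinearMap.adjoint_inner_left, hT, inner_smul_left, inner_ket_left]
    simp
  have h1 : inner ℂ v (ContinuousLinearMap.adjoint T (T v)) = ((‖T v‖ ^ 2 : ℝ) : ℂ) := by
    rw [ContinuousLinearMap.adjoint_inner_right, inner_self_eq_norm_sq_to_K]
    simp
  have h2 := lp.hasSum_inner (𝕜 := ℂ) v (ContinuousLinearMap.adjoint T (T v))
  rw [h1] at h2
  have h3 : HasSum (fun i => d i * ‖v i‖ ^ 2) (‖T v‖ ^ 2) := by
    refine Complex.hasSum_ofReal.mp (h2.congr_fun fun i => ?_)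
    rw [hTv, RCLike.inner_apply, mul_assoc, Complex.mul_conj']
    push_cast
    rfl
  refine hasSum_le (fun i => ?_) h3 ((norm_sq_eq_tsum v).mul_left ρ)
  by_cases hv : v i = 0
  · simp [hv]
  · exact mul_le_mul_of_nonneg_right (hd i hv) (by positivity)

/-- The coordinate projection onto the span of the kets with label in `M`. -/
theorem exists_coordinate_projection (M : Set ι) [DecidablePred (· ∈ M)] :
    ∃ P : QState ι →L[ℂ] QState ι, ∀ v l, (P v) l = if l ∈ M then v l else 0 := by
  classical
  let K : Submodule ℂ (QState ι) := (Submodule.span ℂ (ket '' Mᶜ))ᗮ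
  have : CompleteSpace K := (Submodule.isClosed_orthogonal _).completeSpace_coe
  refine ⟨K.starProjection, fun v l => ?_⟩
  rw [← inner_ket_left, ← Submodule.inner_starProjection_left_eq_right]
  split_ifs with hl
  · have : ket l ∈ K := by
      rw [Submodule.mem_orthogonal]
      intro u hu
      induction hu using Submodule.span_induction with
      | mem x hx =>
        obtain ⟨m, hm, rfl⟩ := hx
        rw [inner_ket_ket, if_neg]
        rintro rfl
        exact hm hl
      | zero => simp
      | add x y _ _ hx hy => rw [inner_add_left, hx, hy, add_zero]
      | smul a x _ hx => rw [inner_smul_left, hx, mul_zero]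
    rw [Submodule.starProjection_eq_self_iff.mpr this, inner_ket_left]
  · have : K.starProjection (ket l) = 0 := by
      rw [Submodule.starProjection_apply_eq_zero_iff]
      exact Submodule.le_orthogonal_orthogonal _ (Submodule.subset_span ⟨l, hl, rfl⟩)
    rw [this, inner_zero_left]

end Kets

theorem card_sub_nonneg {Y : Type} [Fintype Y] (A : Finset Y) :
    0 ≤ (Fintype.card Y : ℝ) - A.card :=
  sub_nonneg.mpr (by exact_mod_cast A.card_le_univ)

section PathRecording

variable {ι Y Y' : Type} [Fintype Y] [DecidableEq Y] [Fintype Y'] [DecidableEq Y']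

/-- `V` sends the ket `j` to the uniform superposition of the kets `g j y` over `y ∉ F j`, where
the pair `(j, y)` can be recovered from `g j y` and `g` increases the size `s` by one. -/
structure IsPathRecording (s : ι → ℕ) (F : ι → Finset Y) (g : ι → Y → ι)
    (V : QState ι →L[ℂ] QState ι) : Prop where
  apply_ket : ∀ j, V (ket j) =
    (↑(Real.sqrt ((Fintype.card Y : ℝ) - (F j).card)) : ℂ)⁻¹ • ∑ y ∈ (F j)ᶜ, ket (g j y)
  inj : ∀ j j' y y', y ∉ F j → y' ∉ F j' → g j y = g j' y' → j = j' ∧ y = y'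
  size_step : ∀ j y, s (g j y) = s j + 1
  card_le : ∀ j, (F j).card ≤ s j

namespace IsPathRecording

variable {s : ι → ℕ} {F : ι → Finset Y} {g : ι → Y → ι} {V : QState ι →L[ℂ] QState ι}
  {F' : ι → Finset Y'} {g' : ι → Y' → ι} {V' : QState ι →L[ℂ] QState ι}

theorem inner_partial [DecidableEq ι] (h : IsPathRecording s F g V) (G : ι → Finset Y)
    (hG : ∀ j, G j ⊆ (F j)ᶜ) (i j : ι) :
    inner ℂ
      ((↑(Real.sqrt ((Fintype.card Y : ℝ) - (F i).card)) : ℂ)⁻¹ •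
        ∑ y ∈ G i, (ket (g i y) : QState ι))
      ((↑(Real.sqrt ((Fintype.card Y : ℝ) - (F j).card)) : ℂ)⁻¹ • ∑ y ∈ G j, ket (g j y)) =
    if i = j then ((((G j).card / ((Fintype.card Y : ℝ) - (F j).card) : ℝ)) : ℂ) else 0 := by
  have key : ∀ y ∈ G i, ∀ z ∈ G j, inner ℂ (ket (g i y) : QState ι) (ket (g j z)) =
      if i = j ∧ y = z then 1 else 0 := by
    intro y hy z hz
    rw [inner_ket_ket]
    refine if_congr ⟨h.inj i j y z ?_ ?_, ?_⟩ rfl rfl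
    · simpa using hG i hy
    · simpa using hG j hz
    · rintro ⟨rfl, rfl⟩; rfl
  rw [inner_smul_left, inner_smul_right, sum_inner]
  simp_rw [inner_sum]
  rw [Finset.sum_congr rfl fun y hy => Finset.sum_congr rfl fun z hz => key y hy z hz]
  split_ifs with hij
  · subst hij
    have hs : ∑ y ∈ G i, ∑ z ∈ G i, (if i = i ∧ y = z then (1 : ℂ) else 0) = (G i).card := by
      simp
    rw [hs, map_inv₀, Complex.conj_ofReal, ← mul_assoc, ← mul_inv, ← Complex.ofReal_mul,
      Real.mul_self_sqrt (card_sub_nonneg _)]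
    push_cast
    rw [div_eq_inv_mul]
  · simp [hij]

theorem inner_apply_ket [DecidableEq ι] (h : IsPathRecording s F g V) (i j : ι) :
    inner ℂ (V (ket i)) (V (ket j)) =
      if i = j then (((if F j = Finset.univ then 0 else 1 : ℝ)) : ℂ) else 0 := by
  rw [h.apply_ket, h.apply_ket, h.inner_partial (fun j => (F j)ᶜ) (fun _ => subset_rfl)]
  refine if_congr Iff.rfl ?_ rfl
  congr 1
  rw [Finset.card_compl, Nat.cast_sub (F j).card_le_univ]
  split_ifs with hF
  · simp [hF]
  · refine div_self (sub_ne_zero.mpr ?_)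
    exact_mod_cast (Finset.card_lt_univ_of_notMem
      (Classical.choose_spec (not_forall.mp (mt Finset.eq_univ_iff_forall.mpr hF)))).ne'

theorem adjoint_mul_self_ket (h : IsPathRecording s F g V) (j : ι) :
    ContinuousLinearMap.adjoint V (V (ket j)) =
      (if F j = Finset.univ then 0 else 1 : ℂ) • ket j := by
  classical
  ext i
  rw [← inner_ket_left, ContinuousLinearMap.adjoint_inner_right, h.inner_apply_ket]
  simp only [lp.coeFn_smul, Pi.smul_apply, ket_apply, smul_eq_mul]
  split_ifs <;> simp

theorem apply_ket_eq_zero (h : IsPathRecording s F g V) {j : ι} (hj : F j = Finset.univ) :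
    V (ket j) = 0 := by
  simp [h.apply_ket, hj]

theorem partial_isometry (h : IsPathRecording s F g V) : V * star V * V = V := by
  refine clm_ext_ket fun j => ?_
  rw [ContinuousLinearMap.star_eq_adjoint]
  simp only [mul_apply_eq_comp]
  rw [h.adjoint_mul_self_ket, map_smul]
  split_ifs with hj
  · simp [h.apply_ket_eq_zero hj]
  · simp

/-- The initial projection of `V` commutes with `V'` whenever `V'` leaves the forbidden set of
`V` unchanged. -/
theorem commute_initial (h : IsPathRecording s F g V) (h' : IsPathRecording s F' g' V')
    (hF : ∀ j y, F (g' j y) = F j) : Commute (star V * V) V' := by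
  refine clm_ext_ket fun j => ?_
  rw [ContinuousLinearMap.star_eq_adjoint]
  simp only [mul_apply_eq_comp]
  rw [h.adjoint_mul_self_ket, h'.apply_ket]
  simp only [map_smul, map_sum, h.adjoint_mul_self_ket, hF, h'.apply_ket]
  rw [← Finset.smul_sum, smul_comm]

theorem apply_ket_ne_zero (h : IsPathRecording s F g V) {j i : ι} (hi : (V (ket j)) i ≠ 0) :
    ∃ y, y ∉ F j ∧ g j y = i := by
  classical
  contrapose! hi
  rw [h.apply_ket, ← inner_ket_left, inner_smul_right, inner_sum, Finset.sum_eq_zero, mul_zero]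
  intro y hy
  rw [inner_ket_ket, if_neg]
  exact fun hh => hi y (by simpa using hy) hh.symm

theorem apply_ne_zero (h : IsPathRecording s F g V) {v : QState ι} {i : ι} (hi : (V v) i ≠ 0) :
    ∃ j y, y ∉ F j ∧ g j y = i := by
  contrapose! hi
  rw [apply_eq_inner]
  have : ContinuousLinearMap.adjoint V (ket i) = 0 := by
    ext j
    rw [adjoint_ket_apply]
    by_contra hne
    obtain ⟨y, hy, rfl⟩ := h.apply_ket_ne_zero (j := j) (i := i)
      (fun h0 => hne (by rw [h0]; simp))
    exact hi j y hy rfl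
  rw [this, inner_zero_left]

/-- If only few of the kets `g j y` have label in `M`, then `V v` has little weight on `M`. -/
theorem norm_sq_restrict_le (h : IsPathRecording s F g V) (M : Set ι)
    {P : QState ι →L[ℂ] QState ι} [DecidablePred (· ∈ M)]
    (hP : ∀ v l, (P v) l = if l ∈ M then v l else 0) {a b k : ℕ}
    (hY : Fintype.card Y = a * b) (hb : 0 < b)
    (hcount : ∀ j, (Finset.univ.filter fun y => g j y ∈ M).card ≤ s j * b)
    {v : QState ι} (hv : ∀ j, v j ≠ 0 → s j ≤ k) :
    ‖P (V v)‖ ^ 2 ≤ (2 * k / a) * ‖v‖ ^ 2 := by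
  classical
  have hPket : ∀ j, (P * V) (ket j) =
      (↑(Real.sqrt ((Fintype.card Y : ℝ) - (F j).card)) : ℂ)⁻¹ •
        ∑ y ∈ (F j)ᶜ.filter (fun y => g j y ∈ M), ket (g j y) := by
    intro j
    have hk : ∀ l, P (ket l) = if l ∈ M then ket l else 0 := by
      intro l
      ext i
      rw [hP]
      by_cases hl : l ∈ M
      · rw [if_pos hl, ket_apply]
        split_ifs with h1 h2 h2
        · rfl
        · rfl
        · exact absurd (h2 ▸ hl) h1
        · rfl
      · rw [if_neg hl, ket_apply]
        split_ifs with h1 h2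
        · exact absurd (h2 ▸ h1) hl
        · rfl
        · rfl
    rw [mul_apply_eq_comp, h.apply_ket, map_smul, map_sum, Finset.sum_filter]
    simp_rw [hk]
  have hmul : P (V v) = (P * V) v := rfl
  rw [hmul]
  refine norm_sq_le_of_gram_diag (P * V)
    (fun j => ((F j)ᶜ.filter fun y => g j y ∈ M).card / ((Fintype.card Y : ℝ) - (F j).card))
    (fun i j => ?_) v _ (fun j hj => ?_)
  · rw [hPket, hPket, h.inner_partial (fun j => (F j)ᶜ.filter fun y => g j y ∈ M)
      (fun _ => Finset.filter_subset _ _)]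
  · have hsj := hv j hj
    have hFj := h.card_le j
    have hc : (((F j)ᶜ.filter fun y => g j y ∈ M).card : ℝ) ≤ k * b := by
      have h1 := Finset.card_le_card
        (Finset.filter_subset_filter (fun y => g j y ∈ M) (Finset.subset_univ (F j)ᶜ))
      exact_mod_cast h1.trans ((hcount j).trans (Nat.mul_le_mul_right b hsj))
    have hc' : (((F j)ᶜ.filter fun y => g j y ∈ M).card : ℝ) ≤
        (Fintype.card Y : ℝ) - (F j).card := by
      rw [← Nat.cast_sub (F j).card_le_univ, ← Finset.card_compl]
      exact_mod_cast Finset.card_filter_le _ _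
    have hFk : ((F j).card : ℝ) ≤ k := by exact_mod_cast hFj.trans hsj
    have hb1 : (1 : ℝ) ≤ b := by exact_mod_cast hb
    have hYr : (Fintype.card Y : ℝ) = a * b := by exact_mod_cast hY
    rcases Nat.eq_zero_or_pos a with ha | ha
    · have : (Fintype.card Y : ℝ) - (F j).card ≤ 0 := by
        rw [hYr, ha]; simp
      rw [le_antisymm this (card_sub_nonneg _), ha]
      simp
    have ha0 : (0 : ℝ) < a := by exact_mod_cast ha
    rw [hYr] at hc' ⊢
    by_cases hk : (2 * k : ℝ) ≤ a * b
    · rcases (show (0 : ℝ) ≤ a * b - (F j).card by linarith).eq_or_lt with h0 | h0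
      · rw [← h0, div_zero]; positivity
      · rw [div_le_div_iff₀ h0 ha0]
        nlinarith [mul_le_mul_of_nonneg_right hc ha0.le,
          mul_nonneg (Nat.cast_nonneg (α := ℝ) k) (show (0 : ℝ) ≤ a * b - 2 * (F j).card by linarith)]
    · push Not at hk
      refine (div_le_one_of_le₀ hc' ?_).trans ?_
      · exact (Nat.cast_nonneg _).trans hc'
      · rw [one_le_div ha0]
        nlinarith

/-- Two path-recording operators whose images share few basis labels are almost orthogonal. -/
theorem norm_adjoint_mul_le (h : IsPathRecording s F g V) (h' : IsPathRecording s F' g' V')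
    {a b k : ℕ} (hY : Fintype.card Y = a * b) (hY' : Fintype.card Y' = a * b) (hb : 0 < b)
    (hcount : ∀ j, {y | ∃ i y', y' ∉ F' i ∧ g' i y' = g j y}.ncard ≤ s j * b)
    (hcount' : ∀ i, {y' | ∃ j y, y ∉ F j ∧ g j y = g' i y'}.ncard ≤ s i * b)
    {v u : QState ι} (hv : ∀ j, v j ≠ 0 → s j ≤ k) (hu : ∀ j, u j ≠ 0 → s j ≤ k) :
    ‖inner ℂ (V' u) (V v)‖ ≤ (2 * k / a) * (‖u‖ * ‖v‖) := by
  classical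
  let M : Set ι := {l | (∃ j y, y ∉ F j ∧ g j y = l) ∧ ∃ i y', y' ∉ F' i ∧ g' i y' = l}
  obtain ⟨P, hP⟩ := exists_coordinate_projection M
  have hin : inner ℂ (V' u) (V v) = inner ℂ (P (V' u)) (P (V v)) := by
    rw [lp.inner_eq_tsum, lp.inner_eq_tsum]
    congr 1
    funext l
    rw [hP, hP]
    split_ifs with hl
    · rfl
    · by_cases h1 : (V v) l = 0
      · simp [h1]
      · by_cases h2 : (V' u) l = 0
        · simp [h2]
        · exact absurd ⟨h.apply_ne_zero h1, h'.apply_ne_zero h2⟩ hl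
  have hVv := h.norm_sq_restrict_le M hP hY hb (fun j => by
    rw [← Set.ncard_coe_finset]
    refine (Set.ncard_le_ncard ?_ (Set.toFinite _)).trans (hcount j)
    intro y hy
    exact (Finset.mem_filter.mp (Finset.mem_coe.mp hy)).2.2) hv
  have hVu := h'.norm_sq_restrict_le M hP hY' hb (fun j => by
    rw [← Set.ncard_coe_finset]
    refine (Set.ncard_le_ncard ?_ (Set.toFinite _)).trans (hcount' j)
    intro y hy
    exact (Finset.mem_filter.mp (Finset.mem_coe.mp hy)).2.1) hu
  rw [hin]
  refine (norm_inner_le_norm _ _).trans (abs_le_of_sq_le_sq' ?_ (by positivity)).2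
  rw [mul_pow, mul_pow, mul_pow]
  calc ‖P (V' u)‖ ^ 2 * ‖P (V v)‖ ^ 2
      ≤ ((2 * k / a) * ‖u‖ ^ 2) * ((2 * k / a) * ‖v‖ ^ 2) := by gcongr
    _ = _ := by ring

end IsPathRecording

end PathRecording

section PartialIsometryAlgebra

variable {A : Type*} [Ring A] [StarRing A] {x y z : A}

theorem commute_initial_star (h : Commute (star x * x) y) : Commute (star x * x) (star y) := by
  have := h.star_star
  simpa using this

theorem partial_isometry_mul (hx : x * star x * x = x) (hy : y * star y * y = y)
    (h : Commute (star x * x) y) : x * y * star (x * y) * (x * y) = x * y := by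
  have h1 := commute_initial_star h
  calc x * y * star (x * y) * (x * y) = x * (y * (star y * (star x * x)) * y) := by
        simp [mul_assoc]
    _ = x * (star x * x) * (y * star y * y) := by
        rw [← h1.eq, ← mul_assoc y, ← h.eq]; simp [mul_assoc]
    _ = x * y := by rw [hy, ← mul_assoc, hx]

theorem final_projection_mul (hx : x * star x * x = x) (h : Commute (star x * x) y) :
    x * y * star (x * y) * x = x * (y * star y) := by
  have h1 := commute_initial_star h
  calc x * y * star (x * y) * x = x * (y * (star y * (star x * x))) := by simp [mul_assoc]
    _ = x * (star x * x) * (y * star y) := by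
        rw [← h1.eq, ← mul_assoc y, ← h.eq]; simp [mul_assoc]
    _ = x * (y * star y) := by rw [← mul_assoc x, hx]

/-- Products of the nested final projections of a chain of partial isometries with the
partial products of the chain. -/
theorem final_projection_chain (hx : x * star x * x = x) (hy : y * star y * y = y)
    (hz : z * star z * z = z) (hxy : Commute (star x * x) y) (hxz : Commute (star x * x) z)
    (hyz : Commute (star y * y) z) :
    x * y * star y * star x * (x * y) = x * y ∧
    x * y * star y * star x * x = x * (y * star y) ∧
    x * y * z * star z * star y * star x * (x * y * z) = x * y * z ∧
    x * y * z * star z * star y * star x * (x * y) = x * y * (z * star z) := by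
  have hxy' := partial_isometry_mul hx hy hxy
  have hcomm : Commute (star (x * y) * (x * y)) z := by
    have h1 : star (x * y) * (x * y) = star x * x * (star y * y) := by
      calc star (x * y) * (x * y) = star y * (star x * x) * y := by simp [mul_assoc]
        _ = _ := by rw [← (commute_initial_star hxy).eq, mul_assoc]
    rw [h1]
    exact hxz.mul_left hyz
  have h1 := partial_isometry_mul hxy' hz hcomm
  have h2 := final_projection_mul hxy' hcomm
  have h3 := final_projection_mul hx hxy
  simp only [star_mul, ← mul_assoc] at *
  exact ⟨hxy', h3, h1, h2⟩

end PartialIsometryAlgebra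

section GluedAlgebra

variable {E : Type*} [NormedAddCommGroup E] [InnerProductSpace ℂ E] [CompleteSpace E]
  {a₁ a₂ a₃ b₁ b₂ b₃ : E →L[ℂ] E}

theorem prV_eq (a b : E →L[ℂ] E) :
    prV a b = a * (1 - b * star b) + (1 - a * star a) * star b := rfl

theorem gluedOp_eq (ha₁ : a₁ * star a₁ * a₁ = a₁) (ha₂ : a₂ * star a₂ * a₂ = a₂)
    (ha₃ : a₃ * star a₃ * a₃ = a₃) (hb₁ : b₁ * star b₁ * b₁ = b₁)
    (hb₂ : b₂ * star b₂ * b₂ = b₂) (hb₃ : b₃ * star b₃ * b₃ = b₃)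
    (ha₃₂ : Commute (star a₃ * a₃) a₂) (ha₃₁ : Commute (star a₃ * a₃) a₁)
    (ha₂₁ : Commute (star a₂ * a₂) a₁) (hb₁₂ : Commute (star b₁ * b₁) b₂)
    (hb₁₃ : Commute (star b₁ * b₁) b₃) (hb₂₃ : Commute (star b₂ * b₂) b₃) :
    gluedOp a₁ b₁ a₂ b₂ a₃ b₃ =
      a₃ * (a₂ * (a₁ * (1 - b₁ * star b₁) +
          (1 - a₁ * star a₁) * ((1 - b₂ * star b₂) * star b₁)) +
        (1 - a₂ * star a₂) * ((1 - b₃ * star b₃) * (star b₂ * star b₁))) +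
      (1 - a₃ * star a₃) * (star b₃ * (star b₂ * star b₁)) := by
  obtain ⟨hA1, hA2, hA3, hA4⟩ := final_projection_chain ha₃ ha₂ ha₁ ha₃₂ ha₃₁ ha₂₁
  obtain ⟨hB1, hB2, hB3, hB4⟩ := final_projection_chain hb₁ hb₂ hb₃ hb₁₂ hb₁₃ hb₂₃
  replace hB1 := congrArg star hB1
  replace hB2 := congrArg star hB2
  replace hB3 := congrArg star hB3
  replace hB4 := congrArg star hB4
  replace hb₁ := congrArg star hb₁
  simp only [star_mul, star_star] at hB1 hB2 hB3 hB4 hb₁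
  simp only [gluedOp, ← ContinuousLinearMap.star_eq_adjoint]
  set PR12 := b₁ * b₂ * star b₂ * star b₁ with hPR12
  set PR123 := b₁ * b₂ * b₃ * star b₃ * star b₂ * star b₁ with hPR123
  set PL32 := a₃ * a₂ * star a₂ * star a₃ with hPL32
  set PL321 := a₃ * a₂ * a₁ * star a₁ * star a₂ * star a₃ with hPL321
  have e1 : PL321 * (a₃ * a₂ * a₁) = a₃ * a₂ * a₁ := hA3
  have e2 : (PL32 - PL321) * (a₃ * a₂ * star b₁) = a₃ * a₂ * (1 - a₁ * star a₁) * star b₁ := by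
    rw [← mul_assoc, sub_mul, hA1, hA4, mul_sub (a₃ * a₂), mul_one]
  have e3 : (a₃ * star a₃ - PL32) * (a₃ * star b₂ * star b₁) =
      a₃ * (1 - a₂ * star a₂) * (star b₂ * star b₁) := by
    rw [mul_assoc a₃ (star b₂), ← mul_assoc, sub_mul, ha₃, hA2, mul_sub a₃, mul_one]
  have f2 : star b₁ * (b₁ * star b₁ - PR12) = (1 - b₂ * star b₂) * star b₁ := by
    have : star b₁ * PR12 = b₂ * star b₂ * star b₁ := by
      simpa only [hPR12, mul_assoc] using hB2
    rw [mul_sub, this, hb₁, sub_mul, one_mul]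
  have f3 : star b₂ * star b₁ * (PR12 - PR123) =
      (1 - b₃ * star b₃) * (star b₂ * star b₁) := by
    have h1 : star b₂ * star b₁ * PR12 = star b₂ * star b₁ := by
      simpa only [hPR12, mul_assoc] using hB1
    have h2 : star b₂ * star b₁ * PR123 = b₃ * star b₃ * (star b₂ * star b₁) := by
      simpa only [hPR123, mul_assoc] using hB4
    rw [mul_sub, h1, h2, sub_mul, one_mul]
  have f4 : star b₃ * star b₂ * star b₁ * PR123 = star b₃ * (star b₂ * star b₁) := by
    simpa only [hPR123, mul_assoc] using hB3
  rw [e1, e2, e3, mul_assoc (a₃ * a₂ * (1 - a₁ * star a₁)), f2,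
    mul_assoc (a₃ * (1 - a₂ * star a₂)), f3, mul_assoc (1 - a₃ * star a₃), f4]
  simp only [mul_add, mul_assoc]

/-- The glued operator differs from the composed operator only by terms containing one of the
overlaps `b₂† a₁`, `b₃† a₂` or their adjoints. -/
theorem composed_sub_glued_eq {A : Type*} [Ring A] [StarRing A] (a₁ a₂ a₃ b₁ b₂ b₃ : A) :
    (a₃ * (1 - b₃ * star b₃) + (1 - a₃ * star a₃) * star b₃) *
        (a₂ * (1 - b₂ * star b₂) + (1 - a₂ * star a₂) * star b₂) *
        (a₁ * (1 - b₁ * star b₁) + (1 - a₁ * star a₁) * star b₁) -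
      (a₃ * (a₂ * (a₁ * (1 - b₁ * star b₁) +
          (1 - a₁ * star a₁) * ((1 - b₂ * star b₂) * star b₁)) +
        (1 - a₂ * star a₂) * ((1 - b₃ * star b₃) * (star b₂ * star b₁))) +
      (1 - a₃ * star a₃) * (star b₃ * (star b₂ * star b₁))) =
    (a₃ * (1 - b₃ * star b₃) + (1 - a₃ * star a₃) * star b₃) *
      (a₂ * (b₂ * (star b₂ * a₁) * star a₁ * star b₁ - a₁ * star (star b₂ * a₁) * star b₂ * star b₁
          - b₂ * (star b₂ * a₁) * (1 - b₁ * star b₁)) +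
        (1 - a₂ * star a₂) * ((star b₂ * a₁) * (1 - b₁ * star b₁)
          - (star b₂ * a₁) * star a₁ * star b₁)) +
    ((1 - a₃ * star a₃) * (star b₃ * a₂) - a₃ * b₃ * (star b₃ * a₂)) *
      (a₁ * (1 - b₁ * star b₁) + (1 - a₁ * star a₁) * ((1 - b₂ * star b₂) * star b₁)) +
    (a₃ * (b₃ * (star b₃ * a₂) * star a₂ - a₂ * star (star b₃ * a₂) * star b₃) -
      (1 - a₃ * star a₃) * (star b₃ * a₂) * star a₂) * (star b₂ * star b₁) := by
  simp only [star_mul, star_star]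
  noncomm_ring

end GluedAlgebra

section Contractions

variable {E : Type*} [NormedAddCommGroup E] [InnerProductSpace ℂ E] [CompleteSpace E]
  {a b a₁ a₂ a₃ b₁ b₂ b₃ : E →L[ℂ] E}

theorem norm_le_one_of_partial_isometry (ha : a * star a * a = a) : ‖a‖ ≤ 1 := by
  have h1 : ‖star a * a‖ = ‖a‖ * ‖a‖ := CStarRing.norm_star_mul_self
  have h2 : ‖star (star a * a) * (star a * a)‖ = ‖star a * a‖ * ‖star a * a‖ :=
    CStarRing.norm_star_mul_self
  have h3 : star (star a * a) * (star a * a) = star a * a := by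
    rw [star_mul, star_star, mul_assoc, ← mul_assoc a, ha]
  rw [h3, h1] at h2
  by_contra! h
  have h4 : 1 < ‖a‖ * ‖a‖ := one_lt_mul h.le h
  nlinarith

theorem inner_apply_one_sub_eq_zero (ha : a * star a * a = a) (x y : E) :
    inner ℂ (a x) ((1 - a * star a) y) = 0 := by
  rw [← ContinuousLinearMap.adjoint_inner_right, ← ContinuousLinearMap.star_eq_adjoint,
    ← mul_apply_eq_comp]
  have h := congrArg star ha
  simp only [star_mul, star_star] at h
  rw [mul_sub, mul_one, h, sub_self]
  exact inner_zero_right _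

theorem norm_sq_add_one_sub (ha : a * star a * a = a) (x y : E) :
    ‖a x + (1 - a * star a) y‖ ^ 2 = ‖a x‖ ^ 2 + ‖(1 - a * star a) y‖ ^ 2 := by
  rw [@norm_add_sq ℂ, inner_apply_one_sub_eq_zero ha]
  simp

theorem norm_sq_star_add_one_sub_le (hb : b * star b * b = b) (x : E) :
    ‖star b x‖ ^ 2 + ‖(1 - b * star b) x‖ ^ 2 ≤ ‖x‖ ^ 2 := by
  have h := norm_sq_add_one_sub hb (star b x) x
  have h1 : b (star b x) + (1 - b * star b) x = x := by simp
  have h2 : star b x = star b (b (star b x)) := by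
    have h := congrArg star hb
    simp only [star_mul, star_star] at h
    exact (DFunLike.congr_fun h x).symm
  have h3 : ‖star b x‖ ≤ ‖b (star b x)‖ := by
    conv_lhs => rw [h2]
    refine (ContinuousLinearMap.le_of_opNorm_le _ ?_ _).trans_eq (one_mul _)
    rw [norm_star]
    exact norm_le_one_of_partial_isometry hb
  rw [h1] at h
  have := pow_le_pow_left₀ (norm_nonneg _) h3 2
  linarith

theorem norm_one_sub_le (hb : b * star b * b = b) : ‖1 - b * star b‖ ≤ 1 := by
  refine ContinuousLinearMap.opNorm_le_bound _ zero_le_one fun x => ?_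
  rw [one_mul]
  refine abs_le_of_sq_le_sq' ?_ (norm_nonneg _) |>.2
  nlinarith [norm_sq_star_add_one_sub_le hb x, sq_nonneg ‖star b x‖]

theorem norm_sq_apply_add_le (ha : a * star a * a = a) (x y : E) :
    ‖a x + (1 - a * star a) y‖ ^ 2 ≤ ‖x‖ ^ 2 + ‖y‖ ^ 2 := by
  rw [norm_sq_add_one_sub ha]
  have h1 := (ContinuousLinearMap.le_of_opNorm_le _ (norm_le_one_of_partial_isometry ha) x)
  have h2 := (ContinuousLinearMap.le_of_opNorm_le _ (norm_one_sub_le ha) y)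
  rw [one_mul] at h1 h2
  gcongr

theorem norm_prV_le (ha : a * star a * a = a) (hb : b * star b * b = b) : ‖prV a b‖ ≤ 1 := by
  refine ContinuousLinearMap.opNorm_le_bound _ zero_le_one fun x => ?_
  rw [one_mul, prV_eq]
  refine abs_le_of_sq_le_sq' ?_ (norm_nonneg _) |>.2
  have h1 := norm_sq_apply_add_le ha ((1 - b * star b) x) (star b x)
  have h2 := norm_sq_star_add_one_sub_le hb x
  calc _ ≤ _ := h1
    _ ≤ _ := by linarith

theorem norm_glued_le (ha₁ : a₁ * star a₁ * a₁ = a₁) (ha₂ : a₂ * star a₂ * a₂ = a₂)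
    (ha₃ : a₃ * star a₃ * a₃ = a₃) (hb₁ : b₁ * star b₁ * b₁ = b₁)
    (hb₂ : b₂ * star b₂ * b₂ = b₂) (hb₃ : b₃ * star b₃ * b₃ = b₃) :
    ‖a₃ * (a₂ * (a₁ * (1 - b₁ * star b₁) +
          (1 - a₁ * star a₁) * ((1 - b₂ * star b₂) * star b₁)) +
        (1 - a₂ * star a₂) * ((1 - b₃ * star b₃) * (star b₂ * star b₁))) +
      (1 - a₃ * star a₃) * (star b₃ * (star b₂ * star b₁))‖ ≤ 1 := by
  refine ContinuousLinearMap.opNorm_le_bound _ zero_le_one fun x => ?_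
  rw [one_mul]
  refine abs_le_of_sq_le_sq' ?_ (norm_nonneg _) |>.2
  set x₁ := star b₁ x
  set x₂ := star b₂ x₁
  set u₁ := a₁ ((1 - b₁ * star b₁) x) + (1 - a₁ * star a₁) ((1 - b₂ * star b₂) x₁)
  set u₂ := a₂ u₁ + (1 - a₂ * star a₂) ((1 - b₃ * star b₃) x₂)
  have h3 : ‖a₃ u₂ + (1 - a₃ * star a₃) (star b₃ x₂)‖ ^ 2 ≤ ‖u₂‖ ^ 2 + ‖star b₃ x₂‖ ^ 2 :=
    norm_sq_apply_add_le ha₃ _ _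
  have h2 : ‖u₂‖ ^ 2 ≤ ‖u₁‖ ^ 2 + ‖(1 - b₃ * star b₃) x₂‖ ^ 2 := norm_sq_apply_add_le ha₂ _ _
  have h1 : ‖u₁‖ ^ 2 ≤ ‖(1 - b₁ * star b₁) x‖ ^ 2 + ‖(1 - b₂ * star b₂) x₁‖ ^ 2 :=
    norm_sq_apply_add_le ha₁ _ _
  have k1 := norm_sq_star_add_one_sub_le hb₁ x
  have k2 := norm_sq_star_add_one_sub_le hb₂ x₁
  have k3 := norm_sq_star_add_one_sub_le hb₃ x₂
  calc _ ≤ _ := h3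
    _ ≤ _ := by linarith

end Contractions

section Banded

variable {ι : Type}

/-- The vector `v` is supported on labels of size at most `k`. -/
def SuppLE (s : ι → ℕ) (k : ℕ) (v : QState ι) : Prop := ∀ j, v j ≠ 0 → s j ≤ k

/-- The operator `T` and its adjoint increase the size of labels by at most `m`. -/
structure IsBanded (s : ι → ℕ) (m : ℕ) (T : QState ι →L[ℂ] QState ι) : Prop where
  apply : ∀ {k v}, SuppLE s k v → SuppLE s (k + m) (T v)
  star_apply : ∀ {k v}, SuppLE s k v → SuppLE s (k + m) (star T v)

/-- A banded contraction. -/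
structure IsBandedContraction (s : ι → ℕ) (m : ℕ) (T : QState ι →L[ℂ] QState ι) : Prop where
  norm_le : ‖T‖ ≤ 1
  banded : IsBanded s m T

/-- On vectors supported on labels of size at most `k`, the operator `T` and its adjoint have norm
at most `c * (k + 1) * ε`. -/
structure IsSmallOp (s : ι → ℕ) (ε c : ℝ) (T : QState ι →L[ℂ] QState ι) : Prop where
  eps_nonneg : 0 ≤ ε
  nonneg : 0 ≤ c
  apply : ∀ {k v}, SuppLE s k v → ‖T v‖ ≤ c * (k + 1) * ε * ‖v‖
  star_apply : ∀ {k v}, SuppLE s k v → ‖star T v‖ ≤ c * (k + 1) * ε * ‖v‖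

variable {s : ι → ℕ} {k m m' : ℕ} {ε c c' : ℝ} {T T' : QState ι →L[ℂ] QState ι} {v w : QState ι}

theorem SuppLE.mono (h : SuppLE s k v) (hk : k ≤ m) : SuppLE s m v :=
  fun j hj => (h j hj).trans hk

theorem SuppLE.add (hv : SuppLE s k v) (hw : SuppLE s k w) : SuppLE s k (v + w) := by
  intro j hj
  by_cases h : v j = 0
  · refine hw j fun h' => hj ?_
    rw [lp.coeFn_add, Pi.add_apply, h, h', add_zero]
  · exact hv j h

theorem suppLE_apply_of_entries (h : ∀ j i, (T (ket j)) i ≠ 0 → s i ≤ s j + m)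
    (hv : SuppLE s k v) : SuppLE s (k + m) (T v) := by
  intro i hi
  by_contra hlt
  refine hi ?_
  rw [apply_eq_inner, lp.inner_eq_tsum]
  refine (tsum_congr fun j => ?_).trans tsum_zero
  rw [adjoint_ket_apply]
  by_cases h1 : v j = 0
  · rw [h1, inner_zero_right]
  · have h2 : (T (ket j)) i = 0 := by
      by_contra h2
      have := h j i h2
      have := hv j h1
      omega
    rw [h2, star_zero, inner_zero_left]

theorem IsBanded.of_entries (h : ∀ j i, (T (ket j)) i ≠ 0 → s i ≤ s j + m ∧ s j ≤ s i + m) :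
    IsBanded s m T where
  apply := suppLE_apply_of_entries fun j i hij => (h j i hij).1
  star_apply := suppLE_apply_of_entries fun j i hij => (h i j fun h0 => hij (by
    rw [ContinuousLinearMap.star_eq_adjoint, adjoint_ket_apply, h0, star_zero])).2

theorem IsBanded.star (h : IsBanded s m T) : IsBanded s m (star T) :=
  ⟨h.star_apply, by rw [star_star]; exact h.apply⟩

theorem IsBanded.mul (h : IsBanded s m T) (h' : IsBanded s m' T') :
    IsBanded s (m + m') (T * T') where
  apply hv := by
    rw [add_comm m, ← add_assoc]
    exact h.apply (h'.apply hv)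
  star_apply hv := by
    rw [star_mul, ← add_assoc]
    exact h'.star_apply (h.star_apply hv)

theorem IsBanded.add (h : IsBanded s m T) (h' : IsBanded s m' T') :
    IsBanded s (m + m') (T + T') where
  apply hv := ((h.apply hv).mono (by omega)).add ((h'.apply hv).mono (by omega))
  star_apply hv := by
    rw [star_add]
    exact ((h.star_apply hv).mono (by omega)).add ((h'.star_apply hv).mono (by omega))

theorem IsBanded.neg (h : IsBanded s m T) : IsBanded s m (-T) where
  apply hv j hj := h.apply hv j fun h0 => hj (by
    rw [_root_.neg_apply, lp.coeFn_neg, Pi.neg_apply, h0, neg_zero])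
  star_apply hv j hj := h.star_apply hv j fun h0 => hj (by
    rw [star_neg, _root_.neg_apply, lp.coeFn_neg, Pi.neg_apply, h0, neg_zero])

theorem isBanded_one : IsBanded s 0 (1 : QState ι →L[ℂ] QState ι) :=
  ⟨fun hv => hv, by rw [star_one]; exact fun hv => hv⟩

namespace IsBandedContraction

theorem star (h : IsBandedContraction s m T) : IsBandedContraction s m (star T) :=
  ⟨by rw [ContinuousLinearMap.star_eq_adjoint, LinearIsometryEquiv.norm_map]; exact h.norm_le,
    h.banded.star⟩

theorem mul (h : IsBandedContraction s m T) (h' : IsBandedContraction s m' T') :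
    IsBandedContraction s (m + m') (T * T') :=
  ⟨(norm_mul_le _ _).trans (mul_le_one₀ h.norm_le (norm_nonneg _) h'.norm_le),
    h.banded.mul h'.banded⟩

theorem one_sub (h : IsBandedContraction s m T) (hT : T * Star.star T * T = T) :
    IsBandedContraction s (m + m) (1 - T * Star.star T) := by
  refine ⟨norm_one_sub_le hT, ?_⟩
  have := isBanded_one.add (h.banded.mul h.banded.star).neg
  rwa [← sub_eq_add_neg, zero_add] at this

theorem norm_apply_le (h : IsBandedContraction s m T) (v : QState ι) : ‖T v‖ ≤ ‖v‖ :=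
  (T.le_of_opNorm_le h.norm_le v).trans_eq (one_mul _)

end IsBandedContraction

namespace IsSmallOp

theorem star (h : IsSmallOp s ε c T) : IsSmallOp s ε c (star T) :=
  ⟨h.eps_nonneg, h.nonneg, h.star_apply, by rw [star_star]; exact h.apply⟩

theorem neg (h : IsSmallOp s ε c T) : IsSmallOp s ε c (-T) where
  eps_nonneg := h.eps_nonneg
  nonneg := h.nonneg
  apply hv := by rw [_root_.neg_apply, norm_neg]; exact h.apply hv
  star_apply hv := by rw [star_neg, _root_.neg_apply, norm_neg]; exact h.star_apply hv

theorem add (h : IsSmallOp s ε c T) (h' : IsSmallOp s ε c' T') :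
    IsSmallOp s ε (c + c') (T + T') where
  eps_nonneg := h.eps_nonneg
  nonneg := add_nonneg h.nonneg h'.nonneg
  apply hv := by
    rw [add_mul, add_mul, add_mul]
    exact (norm_add_le _ _).trans (add_le_add (h.apply hv) (h'.apply hv))
  star_apply hv := by
    rw [add_mul, add_mul, add_mul, star_add]
    exact (norm_add_le _ _).trans (add_le_add (h.star_apply hv) (h'.star_apply hv))

theorem sub (h : IsSmallOp s ε c T) (h' : IsSmallOp s ε c' T') :
    IsSmallOp s ε (c + c') (T - T') := by
  rw [sub_eq_add_neg]
  exact h.add h'.neg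

theorem mul_left (h : IsSmallOp s ε c T) (h' : IsBandedContraction s m T') :
    IsSmallOp s ε (c * (m + 1)) (T' * T) where
  eps_nonneg := h.eps_nonneg
  nonneg := mul_nonneg h.nonneg (by positivity)
  apply {k v} hv := by
    have h0 := h.eps_nonneg
    have h1 := h.nonneg
    refine (h'.norm_apply_le _).trans ((h.apply hv).trans ?_)
    gcongr
    exact le_mul_of_one_le_right h1 (by linarith [Nat.cast_nonneg (α := ℝ) m])
  star_apply {k v} hv := by
    have h0 := h.eps_nonneg
    have h1 := h.nonneg
    rw [star_mul]
    refine (h.star_apply (h'.banded.star_apply hv)).trans ?_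
    have h2 : ((k + m : ℕ) : ℝ) + 1 ≤ (m + 1) * (k + 1) := by
      push_cast
      nlinarith [mul_nonneg (Nat.cast_nonneg (α := ℝ) m) (Nat.cast_nonneg (α := ℝ) k)]
    rw [mul_assoc c ((m : ℝ) + 1)]
    gcongr
    exact h'.star.norm_apply_le v

theorem mul_right (h : IsSmallOp s ε c T) (h' : IsBandedContraction s m T') :
    IsSmallOp s ε (c * (m + 1)) (T * T') := by
  have := (h.star.mul_left h'.star).star
  simpa using this

end IsSmallOp

section

variable {Y Y' : Type} [Fintype Y] [DecidableEq Y] [Fintype Y'] [DecidableEq Y']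
  {F : ι → Finset Y} {g : ι → Y → ι} {V : QState ι →L[ℂ] QState ι}
  {F' : ι → Finset Y'} {g' : ι → Y' → ι} {V' : QState ι →L[ℂ] QState ι}

theorem IsPathRecording.isBandedContraction (h : IsPathRecording s F g V) :
    IsBandedContraction s 1 V := by
  refine ⟨norm_le_one_of_partial_isometry h.partial_isometry, .of_entries fun j i hij => ?_⟩
  obtain ⟨y, -, rfl⟩ := h.apply_ket_ne_zero hij
  rw [h.size_step]
  omega

theorem IsPathRecording.norm_star_mul_le (h : IsPathRecording s F g V)
    (h' : IsPathRecording s F' g' V') {a b : ℕ} (hY : Fintype.card Y = a * b)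
    (hY' : Fintype.card Y' = a * b) (hb : 0 < b)
    (hcount : ∀ j, {y | ∃ i y', y' ∉ F' i ∧ g' i y' = g j y}.ncard ≤ s j * b)
    (hcount' : ∀ i, {y' | ∃ j y, y ∉ F j ∧ g j y = g' i y'}.ncard ≤ s i * b)
    (hv : SuppLE s k v) : ‖(star V' * V) v‖ ≤ 4 * (k + 1) * (a : ℝ)⁻¹ * ‖v‖ := by
  set u := (star V' * V) v with hu
  have husupp : SuppLE s (k + (1 + 1)) u :=
    (h'.isBandedContraction.star.mul h.isBandedContraction).banded.apply hv
  have h1 := h.norm_adjoint_mul_le h' hY hY' hb hcount hcount' (hv.mono (Nat.le_add_right k (1 + 1)))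
    husupp
  have h2 : inner ℂ (V' u) (V v) = ((‖u‖ ^ 2 : ℝ) : ℂ) := by
    rw [← ContinuousLinearMap.adjoint_inner_right, ← ContinuousLinearMap.star_eq_adjoint]
    change inner ℂ u u = _
    rw [inner_self_eq_norm_sq_to_K]
    simp
  rw [h2, Complex.norm_real, Real.norm_of_nonneg (by positivity), div_eq_mul_inv] at h1
  rcases (norm_nonneg u).eq_or_lt with h0 | h0
  · rw [← h0]; positivity
  · have h3 : ‖u‖ ≤ 2 * ((k + (1 + 1) : ℕ) : ℝ) * (a : ℝ)⁻¹ * ‖v‖ := by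
      refine le_of_mul_le_mul_left ?_ h0
      nlinarith
    refine h3.trans ?_
    gcongr ?_ * _ * _
    push_cast
    linarith [Nat.cast_nonneg (α := ℝ) k]

theorem IsPathRecording.isSmallOp_star_mul (h : IsPathRecording s F g V)
    (h' : IsPathRecording s F' g' V') {a b : ℕ} (hY : Fintype.card Y = a * b)
    (hY' : Fintype.card Y' = a * b) (hb : 0 < b)
    (hcount : ∀ j, {y | ∃ i y', y' ∉ F' i ∧ g' i y' = g j y}.ncard ≤ s j * b)
    (hcount' : ∀ i, {y' | ∃ j y, y ∉ F j ∧ g j y = g' i y'}.ncard ≤ s i * b) :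
    IsSmallOp s (a : ℝ)⁻¹ 4 (star V' * V) where
  eps_nonneg := by positivity
  nonneg := by norm_num
  apply hv := h.norm_star_mul_le h' hY hY' hb hcount hcount' hv
  star_apply hv := by
    rw [star_mul, star_star]
    exact h'.norm_star_mul_le h hY' hY hb hcount' hcount hv

end

end Banded

section Hybrid

variable {ι : Type} {s : ι → ℕ} {ε c : ℝ} {O O' : QState ι →L[ℂ] QState ι} {m : ℕ}

/-- One forward and one inverse query with `O` and with `O'` give close states. -/
theorem norm_query_sub_le (hO : ‖O‖ ≤ 1) (hO' : IsBandedContraction s m O')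
    (hsmall : IsSmallOp s ε c (O - O')) {A B : QState ι →L[ℂ] QState ι}
    (hA : IsBandedContraction s 0 A) (hB : IsBandedContraction s 0 B) {k : ℕ} {v : QState ι}
    (hv : SuppLE s k v) (hv1 : ‖v‖ ≤ 1) :
    ‖star O (B (O (A v))) - star O' (B (O' (A v)))‖ ≤ c * (m + 2) * (k + 1) * ε := by
  have hε := hsmall.eps_nonneg
  have hc := hsmall.nonneg
  have hOc : ∀ x, ‖star O x‖ ≤ ‖x‖ := fun x => by
    refine ((star O).le_of_opNorm_le ?_ x).trans_eq (one_mul _)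
    rwa [ContinuousLinearMap.star_eq_adjoint, LinearIsometryEquiv.norm_map]
  have hAv : ‖A v‖ ≤ 1 := (hA.norm_apply_le v).trans hv1
  have hw : ‖B (O' (A v))‖ ≤ 1 :=
    ((hB.norm_apply_le _).trans (hO'.norm_apply_le _)).trans hAv
  have e : star O (B (O (A v))) - star O' (B (O' (A v))) =
      star O (B ((O - O') (A v))) + star (O - O') (B (O' (A v))) := by
    simp
  have h1 : ‖star O (B ((O - O') (A v)))‖ ≤ c * (k + 1) * ε * 1 :=
    ((hOc _).trans (hB.norm_apply_le _)).trans
      ((hsmall.apply (k := k) (hA.banded.apply hv)).trans (by gcongr))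
  have h2 : ‖star (O - O') (B (O' (A v)))‖ ≤ c * ((k + m : ℕ) + 1) * ε * 1 :=
    (hsmall.star_apply (k := k + m)
      (hB.banded.apply (hO'.banded.apply (hA.banded.apply hv)))).trans (by gcongr)
  rw [e]
  refine ((norm_add_le _ _).trans (add_le_add h1 h2)).trans ?_
  have h3 : (0 : ℝ) ≤ c * ε := mul_nonneg hc hε
  push_cast
  nlinarith [mul_nonneg h3 (mul_nonneg (Nat.cast_nonneg (α := ℝ) m) (Nat.cast_nonneg (α := ℝ) k))]

theorem norm_foldl_sub_le {τ : Type*} (hO : ‖O‖ ≤ 1) (hO' : IsBandedContraction s m O')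
    (hsmall : IsSmallOp s ε c (O - O')) {A B : τ → QState ι →L[ℂ] QState ι}
    (hA : ∀ i, IsBandedContraction s 0 (A i)) (hB : ∀ i, IsBandedContraction s 0 (B i))
    (l : List τ) (k : ℕ) (v v' : QState ι) (hv : SuppLE s k v') (hv1 : ‖v'‖ ≤ 1) :
    ‖l.foldl (fun v i => star O (B i (O (A i v)))) v -
        l.foldl (fun v i => star O' (B i (O' (A i v)))) v'‖ ≤
      ‖v - v'‖ + l.length * (c * (m + 2) * ((k + 2 * m * l.length : ℕ) + 1) * ε) := by
  have hε := hsmall.eps_nonneg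
  have hc := hsmall.nonneg
  induction l generalizing k v v' with
  | nil => simp
  | cons i l ih =>
    have hOc : ∀ x, ‖O x‖ ≤ ‖x‖ := fun x => (O.le_of_opNorm_le hO x).trans_eq (one_mul _)
    have hOc' : ∀ x, ‖star O x‖ ≤ ‖x‖ := fun x => by
      refine ((star O).le_of_opNorm_le ?_ x).trans_eq (one_mul _)
      rwa [ContinuousLinearMap.star_eq_adjoint, LinearIsometryEquiv.norm_map]
    have hsupp : SuppLE s (k + m + m) (star O' (B i (O' (A i v')))) :=
      hO'.banded.star_apply ((hB i).banded.apply (hO'.banded.apply ((hA i).banded.apply hv)))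
    have hnorm : ‖star O' (B i (O' (A i v')))‖ ≤ 1 :=
      (hO'.star.norm_apply_le _).trans (((hB i).norm_apply_le _).trans
        ((hO'.norm_apply_le _).trans (((hA i).norm_apply_le _).trans hv1)))
    refine (ih _ _ _ hsupp hnorm).trans ?_
    have h1 : ‖star O (B i (O (A i v))) - star O' (B i (O' (A i v')))‖ ≤
        ‖v - v'‖ + c * (m + 2) * (k + 1) * ε := by
      have h2 := norm_query_sub_le hO hO' hsmall (hA i) (hB i) hv hv1
      have h3 : ‖star O (B i (O (A i v))) - star O (B i (O (A i v')))‖ ≤ ‖v - v'‖ := by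
        simp only [← map_sub]
        exact (hOc' _).trans (((hB i).norm_apply_le _).trans
          ((hOc _).trans ((hA i).norm_apply_le _)))
      exact (norm_sub_le_norm_sub_add_norm_sub _ _ _).trans (add_le_add h3 h2)
    have h4 : k + m + m + 2 * m * l.length = k + 2 * m * (i :: l).length := by
      rw [List.length_cons]; ring
    have h5 : c * (m + 2) * (k + 1) * ε ≤
        c * (m + 2) * ((k + 2 * m * (i :: l).length : ℕ) + 1) * ε := by
      gcongr
      omega
    rw [h4]
    have h6 : (((i :: l).length : ℕ) : ℝ) = l.length + 1 := by simp
    rw [h6, add_one_mul]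
    linarith

end Hybrid

section Databases

variable {σ : Type} [DecidableEq σ]

theorem mem_dbIm {R : Multiset (σ × σ)} {y : σ} : y ∈ dbIm R ↔ ∃ p ∈ R, p.2 = y := by
  simp [dbIm]

theorem card_dbIm_le (R : Multiset (σ × σ)) : (dbIm R).card ≤ Multiset.card R :=
  (Multiset.toFinset_card_le _).trans_eq (Multiset.card_map _ _)

theorem card_dbIm_add_dbInv_le (L R : Multiset (σ × σ)) :
    (dbIm (L + dbInv R)).card ≤ Multiset.card L + Multiset.card R := by
  refine (card_dbIm_le _).trans_eq ?_
  simp [dbInv]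

theorem cons_inj_of_notMem_dbIm {L L' R' : Multiset (σ × σ)} {x x' y : σ}
    (h' : y ∉ dbIm (L' + dbInv R'))
    (e : (x, y) ::ₘ L = (x', y) ::ₘ L') : x = x' ∧ L = L' := by
  have hmem : (x, y) ∈ (x', y) ::ₘ L' := e ▸ Multiset.mem_cons_self _ _
  rcases Multiset.mem_cons.mp hmem with hx | hx
  · obtain rfl := (Prod.ext_iff.mp hx).1
    exact ⟨rfl, (Multiset.cons_inj_right _).mp e⟩
  · exact absurd (mem_dbIm.mpr ⟨_, Multiset.mem_add.mpr (Or.inl hx), rfl⟩) h'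

theorem mem_dbIm_of_cons_eq {L L' : Multiset (σ × σ)} {x y : σ} (e : (x, y) ::ₘ L = L') :
    y ∈ dbIm L' :=
  mem_dbIm.mpr ⟨(x, y), e ▸ Multiset.mem_cons_self _ _, rfl⟩

theorem ncard_le_of_snd_mem {α β : Type} [Fintype α] {B : Set (α × β)} {S : Finset β}
    (h : ∀ y ∈ B, y.2 ∈ S) : B.ncard ≤ S.card * Fintype.card α := by
  refine (Set.ncard_le_ncard (t := ((Finset.univ ×ˢ S : Finset (α × β)) : Set (α × β))) (fun y hy => ?_)
    (Finset.finite_toSet _)).trans_eq ?_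
  · simpa using h y hy
  · rw [Set.ncard_coe_finset, Finset.card_product, Finset.card_univ, mul_comm]

theorem ncard_le_of_fst_mem {α β : Type} [Fintype β] {B : Set (α × β)} {S : Finset α}
    (h : ∀ y ∈ B, y.1 ∈ S) : B.ncard ≤ S.card * Fintype.card β := by
  refine (Set.ncard_le_ncard (t := ((S ×ˢ Finset.univ : Finset (α × β)) : Set (α × β))) (fun y hy => ?_)
    (Finset.finite_toSet _)).trans_eq ?_
  · simpa using h y hy
  · rw [Set.ncard_coe_finset, Finset.card_product, Finset.card_univ]

end Databases

section Lifts

variable {κ δ : Type} [Fintype κ] [DecidableEq κ] (M : Matrix.unitaryGroup κ ℂ)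
  {T : QState (κ × δ) →L[ℂ] QState (κ × δ)}

theorem lift_apply_ket [DecidableEq δ]
    (h : ∀ j : κ × δ, T (ket j) = ∑ p : κ, ((M : Matrix κ κ ℂ) p j.1) • ket (p, j.2))
    (i j : κ × δ) :
    (T (ket j)) i = if i.2 = j.2 then (M : Matrix κ κ ℂ) i.1 j.1 else 0 := by
  rw [← inner_ket_left, h, inner_sum]
  simp only [inner_smul_right, inner_ket_ket, Prod.ext_iff (x := i)]
  split_ifs with hij
  · rw [Finset.sum_eq_single i.1]
    · simp [hij]
    · intro p _ hp
      simp [hp.symm]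
    · simp
  · simp [hij]

theorem snd_eq_of_lift_apply_ne_zero
    (h : ∀ j : κ × δ, T (ket j) = ∑ p : κ, ((M : Matrix κ κ ℂ) p j.1) • ket (p, j.2))
    {i j : κ × δ} (hij : (T (ket j)) i ≠ 0) : i.2 = j.2 := by
  classical
  by_contra hne
  exact hij (by rw [lift_apply_ket M h, if_neg hne])

theorem norm_lift_le
    (h : ∀ j : κ × δ, T (ket j) = ∑ p : κ, ((M : Matrix κ κ ℂ) p j.1) • ket (p, j.2)) :
    ‖T‖ ≤ 1 := by
  classical
  refine ContinuousLinearMap.opNorm_le_bound _ zero_le_one fun v => ?_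
  refine abs_le_of_sq_le_sq' ?_ (by positivity) |>.2
  rw [mul_pow, one_pow]
  refine norm_sq_le_of_gram_diag T (fun _ => 1) (fun i j => ?_) v 1 (fun _ _ => le_rfl)
  rw [h i, sum_inner]
  simp only [inner_smul_left, inner_ket_left, lift_apply_ket M h]
  have hM := congrFun (congrFun (Matrix.mem_unitaryGroup_iff'.mp M.2) i.1) j.1
  rw [Matrix.mul_apply, Matrix.one_apply] at hM
  by_cases hij : i.2 = j.2
  · simp only [hij, if_true]
    refine Eq.trans hM ?_
    simp [Prod.ext_iff, hij]
  · simp [hij, Prod.ext_iff]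

end Lifts

section Systems

variable {n lam : ℕ} {D : Type}

/-- The total size of the six databases of a basis label. -/
def dbSize (j : GluedIdx n lam D) : ℕ :=
  Multiset.card j.2.1.1 + Multiset.card j.2.1.2 + Multiset.card j.2.2.1.1 +
    Multiset.card j.2.2.1.2 + Multiset.card j.2.2.2.1 + Multiset.card j.2.2.2.2

/-- The forbidden outputs of `V_L¹`. -/
def forbL1 (j : GluedIdx n lam D) : Finset (BS n × BS lam) := dbIm (j.2.1.1 + dbInv j.2.1.2)

/-- The forbidden outputs of `V_R¹`. -/
def forbR1 (j : GluedIdx n lam D) : Finset (BS n × BS lam) := dbIm (j.2.1.2 + dbInv j.2.1.1)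

/-- The forbidden outputs of `V_L²`. -/
def forbL2 (j : GluedIdx n lam D) : Finset (BS lam × BS n) := dbIm (j.2.2.1.1 + dbInv j.2.2.1.2)

/-- The forbidden outputs of `V_R²`. -/
def forbR2 (j : GluedIdx n lam D) : Finset (BS lam × BS n) := dbIm (j.2.2.1.2 + dbInv j.2.2.1.1)

/-- The forbidden outputs of `V_L³`. -/
def forbL3 (j : GluedIdx n lam D) : Finset (BS n × BS lam) := dbIm (j.2.2.2.1 + dbInv j.2.2.2.2)

/-- The forbidden outputs of `V_R³`. -/
def forbR3 (j : GluedIdx n lam D) : Finset (BS n × BS lam) := dbIm (j.2.2.2.2 + dbInv j.2.2.2.1)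

/-- The label reached from `j` when `V_L¹` outputs `y`. -/
def stepL1 (j : GluedIdx n lam D) (y : BS n × BS lam) : GluedIdx n lam D :=
  (((y.1, y.2, j.1.1.2.2), j.1.2),
    ((((j.1.1.1, j.1.1.2.1), y) ::ₘ j.2.1.1, j.2.1.2), j.2.2.1, j.2.2.2))

/-- The label reached from `j` when `V_R¹` outputs `y`. -/
def stepR1 (j : GluedIdx n lam D) (y : BS n × BS lam) : GluedIdx n lam D :=
  (((y.1, y.2, j.1.1.2.2), j.1.2),
    ((j.2.1.1, ((j.1.1.1, j.1.1.2.1), y) ::ₘ j.2.1.2), j.2.2.1, j.2.2.2))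

/-- The label reached from `j` when `V_L²` outputs `y`. -/
def stepL2 (j : GluedIdx n lam D) (y : BS lam × BS n) : GluedIdx n lam D :=
  (((j.1.1.1, y.1, y.2), j.1.2),
    (j.2.1, ((j.1.1.2, y) ::ₘ j.2.2.1.1, j.2.2.1.2), j.2.2.2))

/-- The label reached from `j` when `V_R²` outputs `y`. -/
def stepR2 (j : GluedIdx n lam D) (y : BS lam × BS n) : GluedIdx n lam D :=
  (((j.1.1.1, y.1, y.2), j.1.2),
    (j.2.1, (j.2.2.1.1, (j.1.1.2, y) ::ₘ j.2.2.1.2), j.2.2.2))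

/-- The label reached from `j` when `V_L³` outputs `y`. -/
def stepL3 (j : GluedIdx n lam D) (y : BS n × BS lam) : GluedIdx n lam D :=
  (((y.1, y.2, j.1.1.2.2), j.1.2),
    (j.2.1, j.2.2.1, (((j.1.1.1, j.1.1.2.1), y) ::ₘ j.2.2.2.1, j.2.2.2.2)))

/-- The label reached from `j` when `V_R³` outputs `y`. -/
def stepR3 (j : GluedIdx n lam D) (y : BS n × BS lam) : GluedIdx n lam D :=
  (((y.1, y.2, j.1.1.2.2), j.1.2),
    (j.2.1, j.2.2.1, (j.2.2.2.1, ((j.1.1.1, j.1.1.2.1), y) ::ₘ j.2.2.2.2)))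

theorem card_AB : Fintype.card (BS n × BS lam) = 2 ^ lam * 2 ^ n := by
  simp [mul_comm]

theorem card_BC : Fintype.card (BS lam × BS n) = 2 ^ lam * 2 ^ n := by
  simp

theorem two_pow_eq_card_AB : (2 : ℝ) ^ (n + lam) = Fintype.card (BS n × BS lam) := by
  simp [pow_add]

theorem two_pow_eq_card_BC : (2 : ℝ) ^ (n + lam) = Fintype.card (BS lam × BS n) := by
  simp [pow_add, mul_comm]

variable {V : GOp n lam D}

theorem IsVL1.isPathRecording (h : IsVL1 V) :
    IsPathRecording dbSize forbL1 stepL1 V where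
  apply_ket := by
    rintro ⟨⟨⟨a, b, c⟩, d⟩, ⟨L1, R1⟩, ⟨L2, R2⟩, ⟨L3, R3⟩⟩
    rw [h, two_pow_eq_card_AB]
    rfl
  inj := by
    rintro ⟨⟨⟨a, b, c⟩, d⟩, ⟨L1, R1⟩, ⟨L2, R2⟩, ⟨L3, R3⟩⟩
      ⟨⟨⟨a', b', c'⟩, d'⟩, ⟨L1', R1'⟩, ⟨L2', R2'⟩, ⟨L3', R3'⟩⟩ ⟨y₁, y₂⟩ ⟨z₁, z₂⟩ - hz e
    simp only [stepL1, Prod.mk.injEq] at e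
    obtain ⟨⟨⟨_, _, _⟩, _⟩, ⟨_, _⟩, ⟨_, _⟩, _, _⟩ := e
    subst_vars
    obtain ⟨hx, rfl⟩ := cons_inj_of_notMem_dbIm hz (by assumption)
    obtain ⟨rfl, rfl⟩ := Prod.mk.inj hx
    exact ⟨rfl, rfl⟩
  size_step j y := by
    simp only [stepL1, dbSize, Multiset.card_cons]
    omega
  card_le j := by
    refine (card_dbIm_add_dbInv_le _ _).trans ?_
    simp only [dbSize]
    omega

theorem IsVR1.isPathRecording (h : IsVR1 V) :
    IsPathRecording dbSize forbR1 stepR1 V where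
  apply_ket := by
    rintro ⟨⟨⟨a, b, c⟩, d⟩, ⟨L1, R1⟩, ⟨L2, R2⟩, ⟨L3, R3⟩⟩
    rw [h, two_pow_eq_card_AB]
    rfl
  inj := by
    rintro ⟨⟨⟨a, b, c⟩, d⟩, ⟨L1, R1⟩, ⟨L2, R2⟩, ⟨L3, R3⟩⟩
      ⟨⟨⟨a', b', c'⟩, d'⟩, ⟨L1', R1'⟩, ⟨L2', R2'⟩, ⟨L3', R3'⟩⟩ ⟨y₁, y₂⟩ ⟨z₁, z₂⟩ - hz e
    simp only [stepR1, Prod.mk.injEq] at e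
    obtain ⟨⟨⟨_, _, _⟩, _⟩, ⟨_, _⟩, ⟨_, _⟩, _, _⟩ := e
    subst_vars
    obtain ⟨hx, rfl⟩ := cons_inj_of_notMem_dbIm hz (by assumption)
    obtain ⟨rfl, rfl⟩ := Prod.mk.inj hx
    exact ⟨rfl, rfl⟩
  size_step j y := by
    simp only [stepR1, dbSize, Multiset.card_cons]
    omega
  card_le j := by
    refine (card_dbIm_add_dbInv_le _ _).trans ?_
    simp only [dbSize]
    omega

theorem IsVL2.isPathRecording (h : IsVL2 V) :
    IsPathRecording dbSize forbL2 stepL2 V where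
  apply_ket := by
    rintro ⟨⟨⟨a, b, c⟩, d⟩, ⟨L1, R1⟩, ⟨L2, R2⟩, ⟨L3, R3⟩⟩
    rw [h, two_pow_eq_card_BC]
    rfl
  inj := by
    rintro ⟨⟨⟨a, b, c⟩, d⟩, ⟨L1, R1⟩, ⟨L2, R2⟩, ⟨L3, R3⟩⟩
      ⟨⟨⟨a', b', c'⟩, d'⟩, ⟨L1', R1'⟩, ⟨L2', R2'⟩, ⟨L3', R3'⟩⟩ ⟨y₁, y₂⟩ ⟨z₁, z₂⟩ - hz e
    simp only [stepL2, Prod.mk.injEq] at e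
    obtain ⟨⟨⟨_, _, _⟩, _⟩, ⟨_, _⟩, ⟨_, _⟩, _, _⟩ := e
    subst_vars
    obtain ⟨hx, rfl⟩ := cons_inj_of_notMem_dbIm hz (by assumption)
    obtain ⟨rfl, rfl⟩ := Prod.mk.inj hx
    exact ⟨rfl, rfl⟩
  size_step j y := by
    simp only [stepL2, dbSize, Multiset.card_cons]
    omega
  card_le j := by
    refine (card_dbIm_add_dbInv_le _ _).trans ?_
    simp only [dbSize]
    omega

theorem IsVR2.isPathRecording (h : IsVR2 V) :
    IsPathRecording dbSize forbR2 stepR2 V where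
  apply_ket := by
    rintro ⟨⟨⟨a, b, c⟩, d⟩, ⟨L1, R1⟩, ⟨L2, R2⟩, ⟨L3, R3⟩⟩
    rw [h, two_pow_eq_card_BC]
    rfl
  inj := by
    rintro ⟨⟨⟨a, b, c⟩, d⟩, ⟨L1, R1⟩, ⟨L2, R2⟩, ⟨L3, R3⟩⟩
      ⟨⟨⟨a', b', c'⟩, d'⟩, ⟨L1', R1'⟩, ⟨L2', R2'⟩, ⟨L3', R3'⟩⟩ ⟨y₁, y₂⟩ ⟨z₁, z₂⟩ - hz e
    simp only [stepR2, Prod.mk.injEq] at e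
    obtain ⟨⟨⟨_, _, _⟩, _⟩, ⟨_, _⟩, ⟨_, _⟩, _, _⟩ := e
    subst_vars
    obtain ⟨hx, rfl⟩ := cons_inj_of_notMem_dbIm hz (by assumption)
    obtain ⟨rfl, rfl⟩ := Prod.mk.inj hx
    exact ⟨rfl, rfl⟩
  size_step j y := by
    simp only [stepR2, dbSize, Multiset.card_cons]
    omega
  card_le j := by
    refine (card_dbIm_add_dbInv_le _ _).trans ?_
    simp only [dbSize]
    omega

theorem IsVL3.isPathRecording (h : IsVL3 V) :
    IsPathRecording dbSize forbL3 stepL3 V where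
  apply_ket := by
    rintro ⟨⟨⟨a, b, c⟩, d⟩, ⟨L1, R1⟩, ⟨L2, R2⟩, ⟨L3, R3⟩⟩
    rw [h, two_pow_eq_card_AB]
    rfl
  inj := by
    rintro ⟨⟨⟨a, b, c⟩, d⟩, ⟨L1, R1⟩, ⟨L2, R2⟩, ⟨L3, R3⟩⟩
      ⟨⟨⟨a', b', c'⟩, d'⟩, ⟨L1', R1'⟩, ⟨L2', R2'⟩, ⟨L3', R3'⟩⟩ ⟨y₁, y₂⟩ ⟨z₁, z₂⟩ - hz e
    simp only [stepL3, Prod.mk.injEq] at e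
    obtain ⟨⟨⟨_, _, _⟩, _⟩, ⟨_, _⟩, ⟨_, _⟩, _, _⟩ := e
    subst_vars
    obtain ⟨hx, rfl⟩ := cons_inj_of_notMem_dbIm hz (by assumption)
    obtain ⟨rfl, rfl⟩ := Prod.mk.inj hx
    exact ⟨rfl, rfl⟩
  size_step j y := by
    simp only [stepL3, dbSize, Multiset.card_cons]
    omega
  card_le j := by
    refine (card_dbIm_add_dbInv_le _ _).trans ?_
    simp only [dbSize]
    omega

theorem IsVR3.isPathRecording (h : IsVR3 V) :
    IsPathRecording dbSize forbR3 stepR3 V where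
  apply_ket := by
    rintro ⟨⟨⟨a, b, c⟩, d⟩, ⟨L1, R1⟩, ⟨L2, R2⟩, ⟨L3, R3⟩⟩
    rw [h, two_pow_eq_card_AB]
    rfl
  inj := by
    rintro ⟨⟨⟨a, b, c⟩, d⟩, ⟨L1, R1⟩, ⟨L2, R2⟩, ⟨L3, R3⟩⟩
      ⟨⟨⟨a', b', c'⟩, d'⟩, ⟨L1', R1'⟩, ⟨L2', R2'⟩, ⟨L3', R3'⟩⟩ ⟨y₁, y₂⟩ ⟨z₁, z₂⟩ - hz e
    simp only [stepR3, Prod.mk.injEq] at e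
    obtain ⟨⟨⟨_, _, _⟩, _⟩, ⟨_, _⟩, ⟨_, _⟩, _, _⟩ := e
    subst_vars
    obtain ⟨hx, rfl⟩ := cons_inj_of_notMem_dbIm hz (by assumption)
    obtain ⟨rfl, rfl⟩ := Prod.mk.inj hx
    exact ⟨rfl, rfl⟩
  size_step j y := by
    simp only [stepR3, dbSize, Multiset.card_cons]
    omega
  card_le j := by
    refine (card_dbIm_add_dbInv_le _ _).trans ?_
    simp only [dbSize]
    omega

theorem isSmallOp_star_VR2_mul_VL1 {VL1 VR2 : GOp n lam D} (h : IsVL1 VL1) (h' : IsVR2 VR2) :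
    IsSmallOp dbSize (((2 ^ lam : ℕ) : ℝ)⁻¹) 4 (star VR2 * VL1) := by
  refine h.isPathRecording.isSmallOp_star_mul h'.isPathRecording card_AB card_BC (by positivity)
    (fun j => ?_) (fun i => ?_)
  · refine (ncard_le_of_snd_mem (S := (dbIm j.2.2.1.2).image Prod.fst) ?_).trans ?_
    · rintro ⟨y₁, y₂⟩ ⟨i, ⟨z₁, z₂⟩, -, e⟩
      simp only [stepL1, stepR2, Prod.ext_iff] at e
      exact Finset.mem_image.mpr ⟨(z₁, z₂), mem_dbIm_of_cons_eq e.2.2.1.2, e.1.1.2.1⟩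
    · rw [show Fintype.card (BS n) = 2 ^ n by simp]
      refine Nat.mul_le_mul_right _ (Finset.card_image_le.trans ((card_dbIm_le _).trans ?_))
      simp only [dbSize]
      omega
  · refine (ncard_le_of_fst_mem (S := (dbIm i.2.1.1).image Prod.snd) ?_).trans ?_
    · rintro ⟨y₁, y₂⟩ ⟨j, ⟨z₁, z₂⟩, -, e⟩
      simp only [stepL1, stepR2, Prod.ext_iff] at e
      exact Finset.mem_image.mpr ⟨(z₁, z₂), mem_dbIm_of_cons_eq e.2.1.1, e.1.1.2.1⟩
    · rw [show Fintype.card (BS n) = 2 ^ n by simp]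
      refine Nat.mul_le_mul_right _ (Finset.card_image_le.trans ((card_dbIm_le _).trans ?_))
      simp only [dbSize]
      omega

theorem isSmallOp_star_VR3_mul_VL2 {VL2 VR3 : GOp n lam D} (h : IsVL2 VL2) (h' : IsVR3 VR3) :
    IsSmallOp dbSize (((2 ^ lam : ℕ) : ℝ)⁻¹) 4 (star VR3 * VL2) := by
  refine h.isPathRecording.isSmallOp_star_mul h'.isPathRecording card_BC card_AB (by positivity)
    (fun j => ?_) (fun i => ?_)
  · refine (ncard_le_of_fst_mem (S := (dbIm j.2.2.2.2).image Prod.snd) ?_).trans ?_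
    · rintro ⟨y₁, y₂⟩ ⟨i, ⟨z₁, z₂⟩, -, e⟩
      simp only [stepL2, stepR3, Prod.ext_iff] at e
      exact Finset.mem_image.mpr ⟨(z₁, z₂), mem_dbIm_of_cons_eq e.2.2.2.2, e.1.1.2.1⟩
    · rw [show Fintype.card (BS n) = 2 ^ n by simp]
      refine Nat.mul_le_mul_right _ (Finset.card_image_le.trans ((card_dbIm_le _).trans ?_))
      simp only [dbSize]
      omega
  · refine (ncard_le_of_snd_mem (S := (dbIm i.2.2.1.1).image Prod.fst) ?_).trans ?_
    · rintro ⟨y₁, y₂⟩ ⟨j, ⟨z₁, z₂⟩, -, e⟩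
      simp only [stepL2, stepR3, Prod.ext_iff] at e
      exact Finset.mem_image.mpr ⟨(z₁, z₂), mem_dbIm_of_cons_eq e.2.2.1.1, e.1.1.2.1⟩
    · rw [show Fintype.card (BS n) = 2 ^ n by simp]
      refine Nat.mul_le_mul_right _ (Finset.card_image_le.trans ((card_dbIm_le _).trans ?_))
      simp only [dbSize]
      omega

theorem IsLift.isBandedContraction [Fintype D] [DecidableEq D]
    {M : Matrix.unitaryGroup ((BS n × BS lam × BS n) × D) ℂ} {T : GOp n lam D}
    (h : IsLift M T) : IsBandedContraction dbSize 0 T := by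
  have hket : ∀ j : GluedIdx n lam D, T (ket j) = ∑ p : (BS n × BS lam × BS n) × D,
      ((M : Matrix ((BS n × BS lam × BS n) × D) ((BS n × BS lam × BS n) × D) ℂ) p j.1) •
        ket (p, j.2) := by
    rintro ⟨⟨k, d⟩, ⟨L1, R1⟩, ⟨L2, R2⟩, ⟨L3, R3⟩⟩
    exact h k d L1 R1 L2 R2 L3 R3
  refine ⟨norm_lift_le M hket, .of_entries fun j i hij => ?_⟩
  simp [dbSize, snd_eq_of_lift_apply_ne_zero M hket hij]

end Systems

section Comparison

variable {ι : Type} {s : ι → ℕ} {ε : ℝ} {m m' : ℕ}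
  {a b a₁ a₂ a₃ b₁ b₂ b₃ : QState ι →L[ℂ] QState ι}

theorem suppLE_ket (j : ι) : SuppLE s (s j) (ket j) := by
  classical
  intro i hi
  rw [ket_apply] at hi
  rw [(ite_ne_right_iff.mp hi).1]

theorem norm_ket (j : ι) : ‖(ket j : QState ι)‖ = 1 := by
  simp [ket, lp.norm_single]

theorem IsBandedContraction.prV (hma : IsBandedContraction s m a)
    (hmb : IsBandedContraction s m' b)
    (ha : a * Star.star a * a = a) (hb : b * Star.star b * b = b) :
    IsBandedContraction s (m + (m' + m') + (m + m + m')) (_root_.prV a b) :=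
  ⟨norm_prV_le ha hb,
    (hma.mul (hmb.one_sub hb)).banded.add ((hma.one_sub ha).mul hmb.star).banded⟩

/-- If the overlaps `b₂† a₁` and `b₃† a₂` are small, the glued and composed operators are close. -/
theorem isSmallOp_composed_sub_glued
    (ka₁ : IsBandedContraction s 1 a₁) (ka₂ : IsBandedContraction s 1 a₂)
    (ka₃ : IsBandedContraction s 1 a₃) (kb₁ : IsBandedContraction s 1 b₁)
    (kb₂ : IsBandedContraction s 1 b₂) (kb₃ : IsBandedContraction s 1 b₃)
    (ha₁ : a₁ * star a₁ * a₁ = a₁) (ha₂ : a₂ * star a₂ * a₂ = a₂)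
    (ha₃ : a₃ * star a₃ * a₃ = a₃) (hb₁ : b₁ * star b₁ * b₁ = b₁)
    (hb₂ : b₂ * star b₂ * b₂ = b₂) (hb₃ : b₃ * star b₃ * b₃ = b₃)
    (hX : IsSmallOp s ε 4 (star b₂ * a₁)) (hY : IsSmallOp s ε 4 (star b₃ * a₂)) :
    IsSmallOp s ε 2324 (prV a₃ b₃ * prV a₂ b₂ * prV a₁ b₁ -
      (a₃ * (a₂ * (a₁ * (1 - b₁ * star b₁) +
          (1 - a₁ * star a₁) * ((1 - b₂ * star b₂) * star b₁)) +
        (1 - a₂ * star a₂) * ((1 - b₃ * star b₃) * (star b₂ * star b₁))) +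
      (1 - a₃ * star a₃) * (star b₃ * (star b₂ * star b₁)))) := by
  have e : ∀ x y z w : QState ι →L[ℂ] QState ι, x + y * (z + w) = x + (y * z + y * w) :=
    fun x y z w => by rw [mul_add]
  have qa₁ := ka₁.one_sub ha₁
  have qa₂ := ka₂.one_sub ha₂
  have qa₃ := ka₃.one_sub ha₃
  have qb₁ := kb₁.one_sub hb₁
  have qb₂ := kb₂.one_sub hb₂
  have h₁ := (((((hX.mul_left kb₂).mul_right ka₁.star).mul_right kb₁.star).sub
      (((hX.star.mul_left ka₁).mul_right kb₂.star).mul_right kb₁.star)).sub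
      ((hX.mul_left kb₂).mul_right qb₁)).mul_left ka₂
  have h₂ := ((hX.mul_right qb₁).sub ((hX.mul_right ka₁.star).mul_right kb₁.star)).mul_left qa₂
  have h₃ := (hY.mul_left qa₃).sub (hY.mul_left (ka₃.mul kb₃))
  have h₄ := ((((hY.mul_left kb₃).mul_right ka₂.star).sub
      ((hY.star.mul_left ka₂).mul_right kb₃.star)).mul_left ka₃).sub
      ((hY.mul_left qa₃).mul_right ka₂.star)
  have h := (((h₁.add h₂).mul_left (ka₃.prV kb₃ ha₃ hb₃)).add
    ((h₃.mul_right (ka₁.mul qb₁)).add (h₃.mul_right (qa₁.mul (qb₂.mul kb₁.star))))).add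
    (h₄.mul_right (kb₂.star.mul kb₁.star))
  simp only [prV_eq] at h ⊢
  rw [composed_sub_glued_eq, e]
  convert h using 1
  norm_num

end Comparison

/-- **Adversary states under the glued path-recording operator and under three
composed path-recording operators are close.**  There is a universal constant
`C > 0` such that for all `n, λ, t`, every finite auxiliary register `D` (with
initial basis state `d0`), every `2t`-query adversary given by unitaries
`Aq i, Bq i` on `ℋ_A ⊗ ℋ_B ⊗ ℋ_C ⊗ ℋ_D` (lifted to the purified space as
`Alift i, Blift i`) and all path-recording operators `V_L^i, V_R^i`
(`i = 1,2,3`) of the three systems,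
`‖ |A^{V^{glued}, V^{glued,†}}⟩ − |A^{V³V²V¹, (V³V²V¹)†}⟩ ‖₂ ≤ C·t³/2^λ`. -/
theorem glued_and_composed_adversary_states_close :
    ∃ C : ℝ, 0 < C ∧
      ∀ (n lam t : ℕ) (D : Type) [Fintype D] [DecidableEq D] (d0 : D)
        (Aq Bq : Fin t → Matrix.unitaryGroup ((BS n × BS lam × BS n) × D) ℂ)
        (VL1 VR1 VL2 VR2 VL3 VR3 : GOp n lam D)
        (Alift Blift : Fin t → GOp n lam D),
        IsVL1 VL1 → IsVR1 VR1 → IsVL2 VL2 → IsVR2 VR2 → IsVL3 VL3 → IsVR3 VR3 →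
        (∀ i, IsLift (Aq i) (Alift i)) → (∀ i, IsLift (Bq i) (Blift i)) →
        ‖iterQuery t
            (fun i v =>
              ContinuousLinearMap.adjoint (gluedOp VL1 VR1 VL2 VR2 VL3 VR3)
                (Blift i (gluedOp VL1 VR1 VL2 VR2 VL3 VR3 (Alift i v))))
            (ket ((((fun _ => false), (fun _ => false), (fun _ => false)), d0),
              ((0, 0), (0, 0), (0, 0)))) -
          iterQuery t
            (fun i v =>
              ContinuousLinearMap.adjoint (prV VL3 VR3 * prV VL2 VR2 * prV VL1 VR1)
                (Blift i ((prV VL3 VR3 * prV VL2 VR2 * prV VL1 VR1) (Alift i v))))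
            (ket ((((fun _ => false), (fun _ => false), (fun _ => false)), d0),
              ((0, 0), (0, 0), (0, 0))))‖ ≤
          C * (t : ℝ) ^ 3 / 2 ^ lam := by
  refine ⟨2324 * 20 * 37, by norm_num, ?_⟩
  intro n lam t D _ _ d0 Aq Bq VL1 VR1 VL2 VR2 VL3 VR3 Alift Blift h1 h1' h2 h2' h3 h3' hA hB
  have p1 := h1.isPathRecording
  have p1' := h1'.isPathRecording
  have p2 := h2.isPathRecording
  have p2' := h2'.isPathRecording
  have p3 := h3.isPathRecording
  have p3' := h3'.isPathRecording
  have k1 := p1.isBandedContraction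
  have k1' := p1'.isBandedContraction
  have k2 := p2.isBandedContraction
  have k2' := p2'.isBandedContraction
  have k3 := p3.isBandedContraction
  have k3' := p3'.isBandedContraction
  have hglued := gluedOp_eq p1.partial_isometry p2.partial_isometry p3.partial_isometry
    p1'.partial_isometry p2'.partial_isometry p3'.partial_isometry
    (p3.commute_initial p2 fun _ _ => rfl) (p3.commute_initial p1 fun _ _ => rfl)
    (p2.commute_initial p1 fun _ _ => rfl) (p1'.commute_initial p2' fun _ _ => rfl)
    (p1'.commute_initial p3' fun _ _ => rfl) (p2'.commute_initial p3' fun _ _ => rfl)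
  have hO := norm_glued_le p1.partial_isometry p2.partial_isometry p3.partial_isometry
    p1'.partial_isometry p2'.partial_isometry p3'.partial_isometry
  have hsmall := (isSmallOp_composed_sub_glued k1 k2 k3 k1' k2' k3' p1.partial_isometry
    p2.partial_isometry p3.partial_isometry p1'.partial_isometry p2'.partial_isometry
    p3'.partial_isometry (isSmallOp_star_VR2_mul_VL1 h1 h2')
    (isSmallOp_star_VR3_mul_VL2 h2 h3')).neg
  rw [← hglued, neg_sub] at hsmall
  rw [← hglued] at hO
  have hO' := ((k3.prV k3' p3.partial_isometry p3'.partial_isometry).mul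
    (k2.prV k2' p2.partial_isometry p2'.partial_isometry)).mul
    (k1.prV k1' p1.partial_isometry p1'.partial_isometry)
  generalize gluedOp VL1 VR1 VL2 VR2 VL3 VR3 = O at hO hsmall ⊢
  generalize prV VL3 VR3 * prV VL2 VR2 * prV VL1 VR1 = O' at hO' hsmall ⊢
  set j₀ : GluedIdx n lam D := ((((fun _ => false), (fun _ => false), (fun _ => false)), d0),
    ((0, 0), (0, 0), (0, 0)))
  have hj₀ : SuppLE dbSize 0 (ket j₀) := suppLE_ket j₀
  refine (norm_foldl_sub_le hO hO' hsmall (fun i => (hA i).isBandedContraction)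
    (fun i => (hB i).isBandedContraction) (List.finRange t) 0 (ket j₀) (ket j₀) hj₀
    (norm_ket j₀).le).trans ?_
  rw [sub_self, norm_zero, zero_add, List.length_finRange, div_eq_mul_inv]
  push_cast
  have ht : (t : ℝ) ≤ (t : ℝ) ^ 3 ∧ (t : ℝ) ^ 2 ≤ (t : ℝ) ^ 3 := by
    constructor <;> norm_cast
    · exact Nat.le_self_pow (by norm_num) t
    · rcases t.eq_zero_or_pos with rfl | h
      · simp
      · exact Nat.pow_le_pow_right h (by norm_num)
  have hε : (0 : ℝ) ≤ ((2 : ℝ) ^ lam)⁻¹ := by positivity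
  calc _ = (2324 * 20 * (36 * (t : ℝ) ^ 2 + t)) * ((2 : ℝ) ^ lam)⁻¹ := by ring
    _ ≤ _ := by
      refine mul_le_mul_of_nonneg_right ?_ hε
      linarith [ht.1, ht.2]
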